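/- arXiv:1307.6118 — 6 statements merged into one kernel-verified Lean document; each statement's English description precedes it below -/
import Mathlib

section
/- Let 𝔛 be a separable real normed space, 𝔜 ⊆ 𝔛 a closed subspace, X a compact Hausdorff space, and φ : 𝔜 → C(X,ℝ) a bounded linear map. Let m be a C(X)⁺-valued seminorm on 𝔛 that dominates φ and is locally finite with respect to 𝔜. Then for every δ > 0 there exists a bounded linear map φ̃ : 𝔛 → C(X,ℝ) with φ̃(y) = φ(y) for all y ∈ 𝔜 and |φ̃(x)(t)| ≤ m(x)(t) + δ‖x‖ for all x ∈ 𝔛 and all t ∈ X. -/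
open Filter Topology

/-- A finite-dimensional subspace `W` can be shrunk to a complement of `L` in `W ⊔ L`. -/
theorem Submodule.exists_le_disjoint_sup_eq {K V : Type*} [DivisionRing K] [AddCommGroup V]
    [Module K V] (W L : Submodule K V) : ∃ W' ≤ W, Disjoint W' L ∧ W' ⊔ L = W ⊔ L := by
  obtain ⟨C, hC⟩ := (L ⊓ W).exists_isCompl
  refine ⟨C ⊓ W, inf_le_right, ?_, le_antisymm (sup_le_sup_right inf_le_right _) ?_⟩
  · rw [disjoint_iff, inf_assoc, inf_comm W L, inf_comm]
    exact hC.inf_eq_bot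
  · refine sup_le ?_ le_sup_right
    calc W = (L ⊓ W ⊔ C) ⊓ W := by rw [hC.sup_eq_top, top_inf_eq]
      _ = L ⊓ W ⊔ C ⊓ W := sup_inf_assoc_of_le _ inf_le_right
      _ ≤ C ⊓ W ⊔ L := sup_le (inf_le_left.trans le_sup_right) le_sup_left

section

variable {E : Type*} [NormedAddCommGroup E] [NormedSpace ℝ E] {X : Type*} [TopologicalSpace X]

/-- Let `W` be a finite-dimensional subspace disjoint from the closed subspace `L`, and `q` a family
of absolutely homogeneous functions on `W`, equi-Lipschitz and pointwise upper semicontinuous in the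
parameter. A bound of `q` by a multiple of the distance to `L` persists, up to an arbitrarily small
increase of the constant, for nearby parameters. -/
theorem eventually_forall_le_mul_norm_add {W L : Submodule ℝ E} [FiniteDimensional ℝ W]
    (hL : IsClosed (L : Set E)) (hWL : Disjoint W L) {q : E → X → ℝ} {t₀ : X} {K : ℝ}
    (hLip : ∀ w ∈ W, ∀ w' ∈ W, ∀ t, q w t ≤ q w' t + K * ‖w - w'‖)
    (hhom : ∀ (a : ℝ) (w : E) (t : X), q (a • w) t = |a| * q w t)
    (husc : ∀ w ∈ W, UpperSemicontinuousAt (q w) t₀) {ρ ρ' : ℝ} (hρ : ρ < ρ')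
    (h₀ : ∀ w ∈ W, ∀ l ∈ L, q w t₀ ≤ ρ * ‖w + l‖) :
    ∀ᶠ t in 𝓝 t₀, ∀ w ∈ W, ∀ l ∈ L, q w t ≤ ρ' * ‖w + l‖ := by
  have hS : IsCompact ((↑) '' Metric.sphere (0 : W) 1 : Set E) :=
    (isCompact_sphere (0 : W) 1).image continuous_subtype_val
  have key : ∀ᶠ t in 𝓝 t₀, ∀ w ∈ ((↑) '' Metric.sphere (0 : W) 1 : Set E), w ∈ W →
      ∀ l ∈ L, q w t ≤ ρ' * ‖w + l‖ := by
    refine hS.eventually_forall_of_forall_eventually ?_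
    rintro _ ⟨w₀, hw₀, rfl⟩
    have hw₀L : (w₀ : E) ∉ L := fun h => by
      have : (w₀ : E) = 0 := Submodule.disjoint_def.1 hWL _ w₀.2 h
      simp [Submodule.coe_eq_zero.1 this] at hw₀
    obtain ⟨d, hd, hball⟩ := Metric.isOpen_iff.1 hL.isOpen_compl (w₀ : E) hw₀L
    have hdist : ∀ l ∈ L, d ≤ ‖(w₀ : E) + l‖ := by
      intro l hl
      by_contra! hlt
      refine hball (a := -l) ?_ (L.neg_mem hl)
      rwa [mem_ball_iff_norm, ← norm_neg, neg_sub, sub_neg_eq_add]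
    set ε := (ρ' - ρ) * d / 2 with hε
    have hε0 : 0 < ε := by have := sub_pos.2 hρ; positivity
    have h1 := (husc _ w₀.2) (q w₀ t₀ + ε) (by linarith)
    have h2 : ∀ᶠ w : E in 𝓝 (w₀ : E), (|K| + |ρ'|) * ‖w - w₀‖ < ε := by
      have : Continuous fun w : E => (|K| + |ρ'|) * ‖w - w₀‖ := by fun_prop
      exact this.continuousAt.eventually_lt continuousAt_const (by simpa using hε0)
    rw [nhds_prod_eq]
    filter_upwards [h1.prod_mk h2] with ⟨t, w⟩ ⟨h1, h2⟩ hw l hl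
    dsimp only at h1 h2 hw ⊢
    have e1 := hLip w hw w₀ w₀.2 t
    have e2 := h₀ w₀ w₀.2 l hl
    have e3 := mul_le_mul_of_nonneg_left (hdist l hl) (sub_pos.2 hρ).le
    have e4 : ρ' * ‖(w₀ : E) + l‖ ≤ ρ' * ‖w + l‖ + |ρ'| * ‖w - w₀‖ := by
      have : |‖(w₀ : E) + l‖ - ‖w + l‖| ≤ ‖w - w₀‖ := by
        rw [norm_sub_rev w]
        simpa using abs_norm_sub_norm_le ((w₀ : E) + l) (w + l)
      have := (le_abs_self _).trans_eq (abs_mul ρ' (‖(w₀ : E) + l‖ - ‖w + l‖))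
      nlinarith [abs_nonneg ρ']
    have e5 := mul_le_mul_of_nonneg_right (le_abs_self K) (norm_nonneg (w - w₀))
    linarith
  filter_upwards [key] with t ht w hw l hl
  rcases eq_or_ne w 0 with rfl | hw0
  · have h1 := hhom 0 0 t
    have h2 := hhom 0 0 t₀
    have h3 := h₀ 0 hw l hl
    simp only [smul_zero, abs_zero, zero_mul, zero_add] at h1 h2 h3 ⊢
    nlinarith [norm_nonneg l]
  · have hn := norm_pos_iff.2 hw0
    have hu : ‖w‖⁻¹ • w ∈ W := W.smul_mem _ hw
    have := ht (‖w‖⁻¹ • w) ⟨⟨_, hu⟩, by simp [norm_smul, hn.ne'], rfl⟩ hu (‖w‖⁻¹ • l)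
      (L.smul_mem _ hl)
    rw [hhom, ← smul_add, norm_smul, Real.norm_eq_abs, abs_of_pos (inv_pos.2 hn)] at this
    rw [mul_left_comm] at this
    exact le_of_mul_le_mul_left this (inv_pos.2 hn)

variable [CompactSpace X]

theorem LinearMap.exists_norm_le_mul_norm (g : E →ₗ[ℝ] C(X, ℝ)) (W : Submodule ℝ E)
    [FiniteDimensional ℝ W] : ∃ K, ∀ w ∈ W, ‖g w‖ ≤ K * ‖w‖ :=
  ⟨_, fun w hw => (LinearMap.toContinuousLinearMap (g.domRestrict W)).le_opNorm ⟨w, hw⟩⟩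

variable {p : X → Seminorm ℝ E} {C : ℝ}

/-- The compactness argument at a parameter near which `g` and the seminorms vanish on a subspace of
finite codimension. -/
theorem eventually_abs_le_of_eventually_eq_zero (hC : ∀ x t, p t x ≤ C * ‖x‖)
    (hlsc : ∀ x, LowerSemicontinuous fun t => p t x) (g : E →ₗ[ℝ] C(X, ℝ)) {W L : Submodule ℝ E}
    [FiniteDimensional ℝ W] (hL : IsClosed (L : Set E)) {t₀ : X}
    (hz : ∀ᶠ t in 𝓝 t₀, ∀ l ∈ L, p t l = 0 ∧ g l t = 0) {ρ ρ' : ℝ} (hρ : ρ < ρ')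
    (h₀ : ∀ z ∈ W ⊔ L, |g z t₀| ≤ p t₀ z + ρ * ‖z‖) :
    ∀ᶠ t in 𝓝 t₀, ∀ z ∈ W ⊔ L, |g z t| ≤ p t z + ρ' * ‖z‖ := by
  obtain ⟨W', hW'W, hdisj, hsup⟩ := W.exists_le_disjoint_sup_eq L
  have := Submodule.finiteDimensional_of_le hW'W
  obtain ⟨K, hK⟩ := g.exists_norm_le_mul_norm W'
  have hadd : ∀ t, (∀ l ∈ L, p t l = 0 ∧ g l t = 0) → ∀ w, ∀ l ∈ L,
      p t (w + l) = p t w ∧ g (w + l) t = g w t := by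
    intro t ht w l hl
    obtain ⟨hpl, hgl⟩ := ht l hl
    have h1 := map_add_le_add (p t) w l
    have h2 := map_sub_le_add (p t) (w + l) l
    rw [add_sub_cancel_right] at h2
    exact ⟨by linarith, by simp [hgl]⟩
  have key := eventually_forall_le_mul_norm_add (q := fun w t => |g w t| - p t w) (t₀ := t₀)
    (K := K + C) hL hdisj ?_ ?_ ?_ hρ ?_
  · filter_upwards [key, hz] with t ht hzt z hz
    rw [← hsup] at hz
    obtain ⟨w, hw, l, hl, rfl⟩ := Submodule.mem_sup.1 hz
    have := ht w hw l hl
    obtain ⟨e1, e2⟩ := hadd t hzt w l hl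
    rw [e1, e2]
    linarith
  · intro w hw w' hw' t
    have h1 := ((g (w - w')).norm_coe_le_norm t).trans (hK _ (W'.sub_mem hw hw'))
    have h2 := abs_sub_abs_le_abs_sub (g w t) (g w' t)
    have h3 := hC (w' - w) t
    have h4 := map_add_le_add (p t) w (w' - w)
    rw [add_sub_cancel] at h4
    rw [norm_sub_rev] at h3
    simp only [map_sub, ContinuousMap.sub_apply, Real.norm_eq_abs] at h1
    linarith
  · intro a w t
    simp [map_smul_eq_mul, abs_mul, mul_sub]
  · intro w _
    have h1 : UpperSemicontinuousAt (fun t => |g w t|) t₀ :=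
      (by fun_prop : Continuous fun t => |g w t|).continuousAt.upperSemicontinuousAt
    have h2 : UpperSemicontinuousAt (fun t => -p t w) t₀ := fun y hy => by
      filter_upwards [hlsc w t₀ (-y) (by linarith)] with t ht
      linarith
    simpa only [sub_eq_add_neg] using h1.add h2
  · intro w hw l hl
    obtain ⟨e1, e2⟩ := hadd t₀ hz.self_of_nhds w l hl
    have := h₀ (w + l) (hsup ▸ Submodule.add_mem_sup hw hl)
    rw [e1, e2] at this
    linarith

/-- The compactness argument at a parameter at which `g` and the seminorms vanish on the
finite-dimensional subspace `V`. -/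
theorem eventually_abs_le_of_tendsto_zero (hC : ∀ x t, p t x ≤ C * ‖x‖) (g : E →ₗ[ℝ] C(X, ℝ))
    {Y V : Submodule ℝ E} [FiniteDimensional ℝ V] (hY : IsClosed (Y : Set E)) {t₀ : X}
    (hYp : ∀ y ∈ Y, ∀ t, |g y t| ≤ p t y) (hV : ∀ v ∈ V, g v t₀ = 0)
    (hVp : ∀ v ∈ V, Tendsto (fun t => p t v) (𝓝 t₀) (𝓝 0)) {ρ : ℝ} (hρ : 0 < ρ) :
    ∀ᶠ t in 𝓝 t₀, ∀ z ∈ Y ⊔ V, |g z t| ≤ p t z + ρ * ‖z‖ := by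
  obtain ⟨W, hWV, hdisj, hsup⟩ := V.exists_le_disjoint_sup_eq Y
  have := Submodule.finiteDimensional_of_le hWV
  obtain ⟨K, hK⟩ := g.exists_norm_le_mul_norm W
  have hVp₀ : ∀ v ∈ V, p t₀ v = 0 := fun v hv =>
    tendsto_nhds_unique (tendsto_pure_nhds (fun t => p t v) t₀) ((hVp v hv).mono_left (pure_le_nhds t₀))
  have key := eventually_forall_le_mul_norm_add (q := fun w t => |g w t| + p t w) (t₀ := t₀)
    (K := K + C) hY hdisj ?_ ?_ ?_ hρ ?_
  · filter_upwards [key] with t ht z hz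
    rw [sup_comm, ← hsup] at hz
    obtain ⟨w, hw, y, hy, rfl⟩ := Submodule.mem_sup.1 hz
    have h1 := ht w hw y hy
    have h2 := hYp y hy t
    have h3 := map_sub_le_add (p t) (w + y) w
    rw [add_sub_cancel_left] at h3
    have h4 := abs_add_le (g w t) (g y t)
    rw [map_add, ContinuousMap.add_apply]
    linarith
  · intro w hw w' hw' t
    have h1 := ((g (w - w')).norm_coe_le_norm t).trans (hK _ (W.sub_mem hw hw'))
    have h2 := abs_sub_abs_le_abs_sub (g w t) (g w' t)
    have h3 := hC (w - w') t
    have h4 := map_add_le_add (p t) w' (w - w')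
    rw [add_sub_cancel] at h4
    simp only [map_sub, ContinuousMap.sub_apply, Real.norm_eq_abs] at h1
    linarith
  · intro a w t
    simp [map_smul_eq_mul, abs_mul, mul_add]
  · intro w hw
    have h1 : ContinuousAt (fun t => |g w t|) t₀ := by fun_prop
    have h2 : ContinuousAt (fun t => p t w) t₀ := by
      rw [ContinuousAt, hVp₀ w (hWV hw)]
      exact hVp w (hWV hw)
    exact (h1.add h2).upperSemicontinuousAt
  · intro w hw y hy
    simp [hV w (hWV hw), hVp₀ w (hWV hw)]

/-- Hahn-Banach extension of a linear form dominated by a seminorm on a subspace. -/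
theorem Seminorm.exists_extension_of_abs_le (N : Seminorm ℝ E) (S : Submodule ℝ E) (f : E →ₗ[ℝ] ℝ)
    (hf : ∀ z ∈ S, |f z| ≤ N z) : ∃ g : E →ₗ[ℝ] ℝ, (∀ z ∈ S, g z = f z) ∧ ∀ z, |g z| ≤ N z := by
  obtain ⟨g, hg, hgN⟩ := exists_extension_of_le_sublinear ⟨S, f.domRestrict S⟩ N
    (fun c hc x => by rw [map_smul_eq_mul, Real.norm_of_nonneg hc.le]) (map_add_le_add N)
    fun z => (le_abs_self _).trans (hf z z.2)
  refine ⟨g, fun z hz => hg ⟨z, hz⟩, fun z => abs_le'.2 ⟨hgN z, ?_⟩⟩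
  simpa using hgN (-z)

/-- `f` restricts to a linear map on `Y ⊔ V`, with `V` a finite-dimensional subspace of `Yc`, which is
dominated by `p` on `Y`, is dominated by `p` up to `ρ` times the norm on `Y ⊔ V`, and vanishes on `V`
at the parameters in `Z`. -/
structure IsPartialExtension (p : X → Seminorm ℝ E) (Y Yc : Submodule ℝ E) (Z : Set X) (ρ : ℝ)
    (f : E →ₗ[ℝ] C(X, ℝ)) (V : Submodule ℝ E) : Prop where
  le : V ≤ Yc
  finiteDimensional : FiniteDimensional ℝ V
  abs_le : ∀ y ∈ Y, ∀ t, |f y t| ≤ p t y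
  abs_le_add : ∀ z ∈ Y ⊔ V, ∀ t, |f z t| ≤ p t z + ρ * ‖z‖
  eq_zero : ∀ v ∈ V, ∀ t ∈ Z, f v t = 0

/-- A partial extension extends to one more vector, at the cost of increasing the constant. -/
theorem IsPartialExtension.exists_extension [T2Space X] (hC : ∀ x t, p t x ≤ C * ‖x‖)
    (hlsc : ∀ x, LowerSemicontinuous fun t => p t x) {Y Yc : Submodule ℝ E}
    (hY : IsClosed (Y : Set E)) {Z : Set X} (hZc : IsClosed Z)
    (hZ : ∀ t₀ ∈ Z, ∀ x ∈ Yc, Tendsto (fun t => p t x) (𝓝 t₀) (𝓝 0))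
    (hO : ∀ t₀ ∉ Z, ∃ F L : Submodule ℝ E, FiniteDimensional ℝ F ∧ IsClosed (L : Set E) ∧
      F ⊔ L = Y ∧ ∀ᶠ t in 𝓝 t₀, ∀ l ∈ L, p t l = 0)
    {ρ ρ' : ℝ} (hρ₀ : 0 ≤ ρ) (hρ : ρ < ρ') {f : E →ₗ[ℝ] C(X, ℝ)} {V : Submodule ℝ E}
    (hf : IsPartialExtension p Y Yc Z ρ f V) {x : E} (hx : x ∈ Yc) :
    ∃ (f' : E →ₗ[ℝ] C(X, ℝ)) (V' : Submodule ℝ E), IsPartialExtension p Y Yc Z ρ' f' V' ∧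
      V ≤ V' ∧ x ∈ Y ⊔ V' ∧ ∀ z ∈ Y ⊔ V, f' z = f z := by
  by_cases hxS : x ∈ Y ⊔ V
  · refine ⟨f, V, { hf with abs_le_add := fun z hz t => ?_ }, le_rfl, hxS, fun _ _ => rfl⟩
    have := hf.abs_le_add z hz t
    have := mul_le_mul_of_nonneg_right hρ.le (norm_nonneg z)
    linarith
  obtain ⟨lam, hlam, hlamx⟩ := LinearMap.exists_extend_of_notMem (0 : ↥(Y ⊔ V) →ₗ[ℝ] ℝ) hxS 1
  replace hlam : ∀ z ∈ Y ⊔ V, lam z = 0 := fun z hz => by simpa using congr($hlam ⟨z, hz⟩)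
  set S' := Y ⊔ (V ⊔ Submodule.span ℝ {x}) with hS'
  have hS'S : S' = (Y ⊔ V) ⊔ Submodule.span ℝ {x} := (sup_assoc _ _ _).symm
  have := hf.finiteDimensional
  let fc : C(X, ℝ) → E →ₗ[ℝ] C(X, ℝ) := fun c => f + lam.smulRight (c - f x)
  have hfc : ∀ c z t, fc c z t = f z t + lam z * (c t - f x t) := fun c z t => by simp [fc]
  have hfcS : ∀ c, ∀ z ∈ Y ⊔ V, fc c z = f z := fun c z hz => by
    simp [fc, hlam z hz]
  have hfcx : ∀ c, fc c x = c := fun c => by simp [fc, hlamx]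
  have hfcV : ∀ c : C(X, ℝ), ∀ v ∈ V ⊔ Submodule.span ℝ {x}, ∀ t ∈ Z, c t = 0 → fc c v t = 0 := by
    intro c v hv' t ht hct
    obtain ⟨v, hv, w, hw, rfl⟩ := Submodule.mem_sup.1 hv'
    obtain ⟨a, rfl⟩ := Submodule.mem_span_singleton.1 hw
    simp [hfcS c v (Submodule.mem_sup_right hv), hfcx, hct, hf.eq_zero v hv t ht]
  have hsel := exists_continuous_forall_mem_convex_of_local_const (X := X) (E := ℝ)
    (t := fun t => {c | (∀ z ∈ S', |f z t + lam z * (c - f x t)| ≤ p t z + ρ' * ‖z‖) ∧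
      (t ∈ Z → c = 0)}) ?_ ?_
  · obtain ⟨h, hh⟩ := hsel
    refine ⟨fc h, V ⊔ Submodule.span ℝ {x}, ⟨?_, inferInstance, ?_, ?_, ?_⟩, le_sup_left, ?_, hfcS h⟩
    · exact sup_le hf.le (by simpa using hx)
    · intro y hy
      rw [hfcS h y (Submodule.mem_sup_left hy)]
      exact hf.abs_le y hy
    · intro z hz t
      rw [hfc]
      exact (hh t).1 z hz
    · exact fun v hv t ht => hfcV h v hv t ht ((hh t).2 ht)
    · exact Submodule.mem_sup_right (Submodule.mem_sup_right (Submodule.mem_span_singleton_self x))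
  · rintro t c ⟨hc, hc0⟩ d ⟨hd, hd0⟩ a b ha hb hab
    refine ⟨fun z hz => ?_, fun ht => by simp [hc0 ht, hd0 ht]⟩
    have h1 := _root_.abs_le.1 (hc z hz)
    have h2 := _root_.abs_le.1 (hd z hz)
    obtain rfl : b = 1 - a := by linarith
    rw [smul_eq_mul, smul_eq_mul, _root_.abs_le]
    constructor <;> nlinarith
  · intro t₀
    by_cases ht₀ : t₀ ∈ Z
    · refine ⟨0, ?_⟩
      have hV : V ⊔ Submodule.span ℝ {x} ≤ Yc := sup_le hf.le (by simpa using hx)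
      filter_upwards [eventually_abs_le_of_tendsto_zero hC (fc 0) hY
        (fun y hy t => by
          rw [hfcS 0 y (Submodule.mem_sup_left hy)]
          exact hf.abs_le y hy t)
        (fun v hv => hfcV 0 v hv t₀ ht₀ rfl) (fun v hv => hZ t₀ ht₀ v (hV hv))
        (hρ₀.trans_lt hρ)] with t ht
      exact ⟨fun z hz => by simpa [hfc] using ht z hz, fun _ => rfl⟩
    · obtain ⟨F, L, _, hLc, hFL, hL⟩ := hO t₀ ht₀
      let N : Seminorm ℝ E := p t₀ + ρ.toNNReal • normSeminorm ℝ E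
      have hN : ∀ z, N z = p t₀ z + ρ * ‖z‖ := fun z => by
        simp [N, NNReal.smul_def, hρ₀]
      obtain ⟨g, hg, hgN⟩ := N.exists_extension_of_abs_le (Y ⊔ V)
        ((ContinuousMap.evalCLM ℝ t₀ : C(X, ℝ) →L[ℝ] ℝ).toLinearMap ∘ₗ f)
        fun z hz => (hf.abs_le_add z hz t₀).trans_eq (hN z).symm
      replace hg : ∀ z ∈ Y ⊔ V, g z = f z t₀ := hg
      have hFL' : F ⊔ (V ⊔ Submodule.span ℝ {x}) ⊔ L = S' := by
        rw [hS', ← hFL, sup_right_comm]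
      refine ⟨g x, ?_⟩
      have hL' : ∀ᶠ t in 𝓝 t₀, ∀ l ∈ L, p t l = 0 ∧ fc (.const X (g x)) l t = 0 := by
        filter_upwards [hL] with t ht l hl
        have hlY : l ∈ Y := hFL ▸ Submodule.mem_sup_right hl
        refine ⟨ht l hl, ?_⟩
        rw [hfcS _ l (Submodule.mem_sup_left hlY), ← abs_nonpos_iff, ← ht l hl]
        exact hf.abs_le l hlY t
      have key := eventually_abs_le_of_eventually_eq_zero hC hlsc (fc (.const X (g x)))
        (W := F ⊔ (V ⊔ Submodule.span ℝ {x})) hLc hL' hρ ?_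
      · filter_upwards [key, hZc.isOpen_compl.mem_nhds ht₀] with t ht htZ
        rw [hFL'] at ht
        exact ⟨fun z hz => by simpa [hfc] using ht z hz, fun h => absurd h htZ⟩
      · rw [hFL', hS'S]
        intro z hz
        obtain ⟨s, hs, w, hw, rfl⟩ := Submodule.mem_sup.1 hz
        obtain ⟨a, rfl⟩ := Submodule.mem_span_singleton.1 hw
        rw [← hN]
        convert hgN (s + a • x) using 2
        simp [hfcS _ s hs, hfcx, hg s hs]

/-- A densely defined linear map dominated by a bounded family of seminorms extends continuously. -/
theorem LinearPMap.exists_continuousLinearMap (hC : ∀ x t, p t x ≤ C * ‖x‖) {δ : ℝ} (hδ : 0 ≤ δ)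
    (D : E →ₗ.[ℝ] C(X, ℝ)) (hdense : Dense (D.domain : Set E))
    (hD : ∀ (z : D.domain) (t : X), |D z t| ≤ p t z + δ * ‖z‖) :
    ∃ ψ : E →L[ℝ] C(X, ℝ), (∀ z : D.domain, ψ z = D z) ∧
      ∀ x t, |ψ x t| ≤ p t x + δ * ‖x‖ := by
  have hrange : DenseRange D.domain.subtype := by simpa [DenseRange] using! hdense
  have hnorm : ∃ M, ∀ z, ‖D.toFun z‖ ≤ M * ‖D.domain.subtype z‖ := by
    refine ⟨|C| + δ, fun z => (ContinuousMap.norm_le _ (by positivity)).2 fun t => ?_⟩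
    have h1 := hD z t
    have h2 := hC z t
    have h3 := mul_le_mul_of_nonneg_right (le_abs_self C) (norm_nonneg (z : E))
    rw [add_mul]
    exact h1.trans (add_le_add (h2.trans h3) le_rfl)
  have hψ := LinearMap.extendOfNorm_eq hrange hnorm
  refine ⟨D.toFun.extendOfNorm D.domain.subtype, hψ, fun x t => ?_⟩
  have hp : Continuous (p t) := by
    have hC' : ∀ y, p t y ≤ |C| * ‖y‖ := fun y =>
      (hC y t).trans (mul_le_mul_of_nonneg_right (le_abs_self C) (norm_nonneg y))
    exact Seminorm.continuous_of_le
      (q := C.nnabs • normSeminorm ℝ E) (by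
        change Continuous fun y => |C| * ‖y‖
        fun_prop) fun y => hC' y
  refine hdense.induction (P := fun x =>
    |D.toFun.extendOfNorm D.domain.subtype x t| ≤ p t x + δ * ‖x‖) (fun z hz => ?_)
    (isClosed_le (by fun_prop) (by fun_prop)) x
  exact (congrArg (fun u : C(X, ℝ) => |u t|) (hψ ⟨z, hz⟩)).trans_le (hD ⟨z, hz⟩ t)

/-- Iterating the one-vector extension along a sequence gives a densely defined extension. -/
theorem exists_linearPMap_extension [T2Space X] (hC : ∀ x t, p t x ≤ C * ‖x‖)
    (hlsc : ∀ x, LowerSemicontinuous fun t => p t x) {Y Yc : Submodule ℝ E}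
    (hY : IsClosed (Y : Set E)) {Z : Set X} (hZc : IsClosed Z)
    (hZ : ∀ t₀ ∈ Z, ∀ x ∈ Yc, Tendsto (fun t => p t x) (𝓝 t₀) (𝓝 0))
    (hO : ∀ t₀ ∉ Z, ∃ F L : Submodule ℝ E, FiniteDimensional ℝ F ∧ IsClosed (L : Set E) ∧
      F ⊔ L = Y ∧ ∀ᶠ t in 𝓝 t₀, ∀ l ∈ L, p t l = 0)
    {δ : ℝ} (hδ : 0 < δ) (f : E →ₗ[ℝ] C(X, ℝ)) (hf : ∀ y ∈ Y, ∀ t, |f y t| ≤ p t y)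
    (x : ℕ → E) (hx : ∀ n, x n ∈ Yc) :
    ∃ D : E →ₗ.[ℝ] C(X, ℝ), Y ≤ D.domain ∧ (∀ n, x n ∈ D.domain) ∧
      (∀ z : D.domain, (z : E) ∈ Y → D z = f z) ∧
      ∀ (z : D.domain) (t : X), |D z t| ≤ p t z + δ * ‖z‖ := by
  let ρ : ℕ → ℝ := fun n => δ * (1 - 1 / (n + 1))
  have hρ₀ : ∀ n, 0 ≤ ρ n := fun n => by
    refine mul_nonneg hδ.le (sub_nonneg.2 ?_)
    rw [div_le_one (by positivity)]
    linarith [n.cast_nonneg (α := ℝ)]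
  have hρ : ∀ n, ρ n < ρ (n + 1) := fun n => by
    refine mul_lt_mul_of_pos_left (sub_lt_sub_left ?_ 1) hδ
    exact one_div_lt_one_div_of_lt (by positivity) (by push_cast; linarith)
  have hρδ : ∀ n, ρ n ≤ δ := fun n => by
    refine mul_le_of_le_one_right hδ.le (sub_le_self _ (by positivity))
  let σ : ℕ → Type _ := fun n =>
    {s : (E →ₗ[ℝ] C(X, ℝ)) × Submodule ℝ E // IsPartialExtension p Y Yc Z (ρ n) s.1 s.2}
  have step : ∀ n (s : σ n), ∃ s' : σ (n + 1), s.1.2 ≤ s'.1.2 ∧ x n ∈ Y ⊔ s'.1.2 ∧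
      ∀ z ∈ Y ⊔ s.1.2, s'.1.1 z = s.1.1 z := fun n s => by
    obtain ⟨f', V', h, h'⟩ :=
      s.2.exists_extension hC hlsc hY hZc hZ hO (hρ₀ n) (hρ n) (hx n)
    exact ⟨⟨(f', V'), h⟩, h'⟩
  choose next hle hmem heq using step
  have h₀ : IsPartialExtension p Y Yc Z (ρ 0) f ⊥ :=
    { le := bot_le
      finiteDimensional := inferInstance
      abs_le := hf
      abs_le_add := fun z hz t => by simpa [ρ] using hf z (by simpa using hz) t
      eq_zero := fun v hv t _ => by simp [(Submodule.mem_bot ℝ).1 hv] }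
  let u : ∀ n, σ n := fun n => Nat.rec ⟨(f, ⊥), h₀⟩ next n
  let G : ℕ → E →ₗ.[ℝ] C(X, ℝ) := fun n => ⟨Y ⊔ (u n).1.2, (u n).1.1.domRestrict _⟩
  have hG : Monotone G := monotone_nat_of_le_succ fun n =>
    ⟨sup_le_sup_left (hle n (u n)) Y, fun z z' hzz' => by
      change (u n).1.1 z = (u (n + 1)).1.1 z'
      rw [← hzz']
      exact (heq n (u n) z z.2).symm⟩
  have hdir : DirectedOn (· ≤ ·) (Set.range G) := directedOn_range.2 hG.directed_le
  have hGD : ∀ n, G n ≤ LinearPMap.sSup _ hdir := fun n =>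
    LinearPMap.le_sSup hdir (Set.mem_range_self n)
  refine ⟨LinearPMap.sSup _ hdir, le_sup_left.trans (hGD 0).1, fun n => (hGD (n + 1)).1 (hmem n (u n)),
    fun z hz => ?_, fun z t => ?_⟩
  · exact ((hGD 0).2 (x := ⟨z, Submodule.mem_sup_left hz⟩) rfl).symm
  · obtain ⟨_, ⟨n, rfl⟩, hn⟩ := (LinearPMap.mem_domain_sSup_iff (Set.range_nonempty G) hdir).1 z.2
    rw [← (hGD n).2 (x := ⟨z, hn⟩) rfl]
    refine ((u n).2.abs_le_add z hn t).trans ?_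
    gcongr
    exacts [hρδ n, le_rfl]

end

/-- Lemma 1, locally finite case. Let `E` be a separable real normed
space, `Y ⊆ E` a closed subspace, `X` a compact Hausdorff space and `φ : Y → C(X, ℝ)` a
bounded linear map.  Let `m` be a `C(X)⁺`-valued seminorm on `E` (nonnegative, lower
semicontinuous, subadditive and absolutely homogeneous pointwise) dominating `φ` and
locally finite with respect to `Y`.  Then for every `δ > 0` there is a bounded linear
extension `ψ` of `φ` to all of `E` with `|ψ x t| ≤ m x t + δ‖x‖`. -/
theorem stmt0
    {E : Type*} [NormedAddCommGroup E] [NormedSpace ℝ E]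
    [TopologicalSpace.SeparableSpace E]
    {X : Type*} [TopologicalSpace X] [CompactSpace X] [T2Space X]
    (Y : Submodule ℝ E) (hYclosed : IsClosed (Y : Set E))
    (φ : Y →L[ℝ] C(X, ℝ))
    (m : E → X → ℝ)
    (hm_nonneg : ∀ x t, 0 ≤ m x t)
    (hm_lsc : ∀ x, LowerSemicontinuous (m x))
    (hm_subadd : ∀ x y t, m (x + y) t ≤ m x t + m y t)
    (hm_smul : ∀ (a : ℝ) (x : E) (t : X), m (a • x) t = |a| * m x t)
    (hdom : ∀ (y : Y) (t : X), |φ y t| ≤ m (y : E) t)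
    -- `m` is locally finite with respect to `Y` :
    (hbdd : ∃ C > 0, ∀ x t, m x t ≤ C * ‖x‖)
    (hlf : ∃ Yc : Submodule ℝ E, Dense ((Y ⊔ Yc : Submodule ℝ E) : Set E) ∧
      ∀ t₀ : X,
        (∀ x ∈ Yc, ∀ ε > 0, ∃ U ∈ nhds t₀, ∀ t ∈ U, m x t < ε) ∨
        (∃ F L : Submodule ℝ E, F ≤ Y ∧ L ≤ Y ∧ FiniteDimensional ℝ F ∧ F ⊔ L = Y ∧
          ∃ U ∈ nhds t₀, ∀ y ∈ L, ∀ t ∈ U, m y t = 0))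
    (δ : ℝ) (hδ : 0 < δ) :
    ∃ ψ : E →L[ℝ] C(X, ℝ),
      (∀ y : Y, ψ (y : E) = φ y) ∧
      ∀ (x : E) (t : X), |ψ x t| ≤ m x t + δ * ‖x‖ := by
  obtain ⟨C, -, hC⟩ := hbdd
  obtain ⟨Yc, hdense, hlf⟩ := hlf
  let p : X → Seminorm ℝ E := fun t =>
    Seminorm.of (m · t) (hm_subadd · · t) fun a x => hm_smul a x t
  let Z : Set X := {t₀ | ¬ ∃ F L : Submodule ℝ E, FiniteDimensional ℝ F ∧ IsClosed (L : Set E) ∧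
      F ⊔ L = Y ∧ ∀ᶠ t in nhds t₀, ∀ l ∈ L, p t l = 0}
  have hZc : IsClosed Z := by
    rw [← isOpen_compl_iff, isOpen_iff_eventually]
    intro t₀ ht₀
    obtain ⟨F, L, hF, hL, hFL, h⟩ := not_not.1 ht₀
    filter_upwards [eventually_eventually_nhds.2 h] with t ht
    exact not_not.2 ⟨F, L, hF, hL, hFL, ht⟩
  have hZ : ∀ t₀ ∈ Z, ∀ x ∈ Yc, Tendsto (fun t => p t x) (nhds t₀) (nhds 0) := by
    intro t₀ ht₀ x hx
    rcases hlf t₀ with h | ⟨F, L, -, hLY, hF, hFL, U, hU, h⟩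
    · refine tendsto_order.2 ⟨fun a ha => .of_forall fun t => ha.trans_le (hm_nonneg x t),
        fun a ha => ?_⟩
      obtain ⟨U, hU, h⟩ := h x hx a ha
      exact eventually_of_mem hU h
    · have hLY' : L.topologicalClosure ≤ Y := L.topologicalClosure_minimal hLY hYclosed
      refine absurd ⟨F, L.topologicalClosure, hF, L.isClosed_topologicalClosure,
        le_antisymm (sup_le (le_sup_left.trans_eq hFL) hLY')
          (hFL.symm.trans_le (sup_le_sup_left L.le_topologicalClosure F)), ?_⟩ ht₀
      filter_upwards [hU] with t ht l hl
      refine le_antisymm (le_of_forall_pos_lt_add fun ε hε => ?_) (hm_nonneg l t)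
      obtain ⟨l', hl', hll'⟩ := Metric.mem_closure_iff.1 hl (ε / (|C| + 1)) (by positivity)
      have h1 := hm_subadd (l - l') l' t
      rw [sub_add_cancel, h l' hl' t ht] at h1
      have h2 := hC (l - l') t
      rw [dist_eq_norm, lt_div_iff₀ (by positivity)] at hll'
      have h3 := mul_le_mul_of_nonneg_right (le_abs_self C) (norm_nonneg (l - l'))
      have h4 := norm_nonneg (l - l')
      change m l t < 0 + ε
      linarith
  obtain ⟨f, hf⟩ := LinearMap.exists_extend φ.toLinearMap
  replace hf : ∀ y : Y, f y = φ y := fun y => congr($hf y)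
  have := UniformSpace.secondCountable_of_separable E
  obtain ⟨D, hYD, hxD, hDf, hD⟩ := exists_linearPMap_extension (p := p) hC hm_lsc hYclosed hZc hZ
    (fun t₀ ht₀ => not_not.1 ht₀) hδ f (fun y hy t => (hf ⟨y, hy⟩).symm ▸ hdom ⟨y, hy⟩ t)
    (fun n => (TopologicalSpace.denseSeq Yc n : E)) fun n => (TopologicalSpace.denseSeq Yc n).2
  have hYc : (Yc : Set E) ⊆ closure D.domain := fun x hx =>
    map_mem_closure continuous_subtype_val (TopologicalSpace.denseRange_denseSeq Yc ⟨x, hx⟩)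
      (by rintro _ ⟨n, rfl⟩; exact hxD n)
  have hDd : Dense (D.domain : Set E) := by
    have : Y ⊔ Yc ≤ D.domain.topologicalClosure :=
      sup_le (hYD.trans D.domain.le_topologicalClosure) hYc
    exact dense_closure.1 (hdense.mono this)
  obtain ⟨ψ, hψD, hψ⟩ := D.exists_continuousLinearMap hC hδ.le hDd hD
  exact ⟨ψ, fun y => (hψD ⟨y, hYD y.2⟩).trans ((hDf _ y.2).trans (hf y)), hψ⟩
end

section
/- Let A be a unital C*-algebra, X a compact Hausdorff space, and φ : A → C(X,ℂ) a self-adjoint absolutely continuous linear map. Then there exist positive linear maps φ₊, φ₋ : A → C(X,ℂ) such that φ = φ₊ − φ₋ and, for every t ∈ X, ‖φ_t‖ = ‖(φ₊)_t‖ + ‖(φ₋)_t‖. -/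
/-- For a bounded linear map `φ : A → C(X, ℂ)` and `t ∈ X`, the functional
`φ_t : A → ℂ`, `a ↦ φ(a)(t)`, obtained by composing with evaluation at `t`. -/
noncomputable def fiberFunctional {A : Type*} [CStarAlgebra A]
    {X : Type*} [TopologicalSpace X] [CompactSpace X]
    (φ : A →L[ℂ] C(X, ℂ)) (t : X) : A →L[ℂ] ℂ :=
  (ContinuousMap.evalCLM ℂ t).comp φ

/-- A linear map `ψ : A → C(X, ℂ)` is positive if `ψ a` is a nonnegative
real-valued function whenever `0 ≤ a` in `A`. -/
def IsPosMap {A : Type*} [CStarAlgebra A] [PartialOrder A] [StarOrderedRing A]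
    {X : Type*} [TopologicalSpace X] [CompactSpace X]
    (ψ : A →L[ℂ] C(X, ℂ)) : Prop :=
  ∀ a : A, 0 ≤ a → ∀ t : X, (ψ a t).im = 0 ∧ 0 ≤ (ψ a t).re

/-- A function that is locally uniformly approximated by continuous functions, in the sense that
each point has neighbourhoods with arbitrarily good continuous approximants, is continuous. -/
theorem continuous_of_forall_eventually_dist_le {X E : Type*} [TopologicalSpace X]
    [PseudoMetricSpace E] {f : X → E}
    (h : ∀ t₀, ∀ ε > 0, ∃ g : X → E, Continuous g ∧ ∀ᶠ t in nhds t₀, dist (f t) (g t) ≤ ε) :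
    Continuous f :=
  continuous_of_locally_uniform_approx_of_continuousAt fun t₀ u hu ↦ by
    obtain ⟨ε, hε, hεu⟩ := Metric.mem_uniformity_dist.mp hu
    obtain ⟨g, hg, hfg⟩ := h t₀ (ε / 2) (half_pos hε)
    exact ⟨_, hfg, g, hg.continuousAt, fun t ht ↦ hεu (lt_of_le_of_lt ht (half_lt_self hε))⟩

section PositiveFunctional

open scoped ComplexOrder

variable {A : Type*} [CStarAlgebra A]

theorem re_apply_realPart (f : A →L[ℂ] ℂ) (hf : ∀ a, f (star a) = star (f a)) (a : A) :
    (f (realPart a : A)).re = (f a).re := by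
  rw [realPart_apply_coe, ← Complex.coe_smul, map_smul, map_add, hf]
  simp
  ring

theorem exists_selfAdjoint_lt_re_apply (f : A →L[ℂ] ℂ) (hf : ∀ a, f (star a) = star (f a))
    {r : ℝ} (hr : r < ‖f‖) : ∃ a : A, IsSelfAdjoint a ∧ ‖a‖ ≤ 1 ∧ r < (f a).re := by
  rcases lt_or_ge r 0 with h | h
  · exact ⟨0, .zero A, by simp, by simpa⟩
  obtain ⟨x, hx, hrx⟩ := f.exists_lt_apply_of_lt_opNorm hr
  obtain ⟨c, hc, hcx⟩ := RCLike.exists_norm_eq_mul_self (f x)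
  refine ⟨realPart (c • x), (realPart (c • x)).2, ?_, ?_⟩
  · refine (realPart.norm_le (c • x)).trans ?_
    rw [norm_smul, hc, one_mul]
    exact hx.le
  · rw [re_apply_realPart f hf, map_smul, smul_eq_mul, ← hcx]
    exact hrx

variable [PartialOrder A]

namespace PositiveLinearMap

theorem im_eq_zero_and_re_nonneg (p : A →ₚ[ℂ] ℂ) {a : A} (ha : 0 ≤ a) :
    (p a).im = 0 ∧ 0 ≤ (p a).re :=
  have h := Complex.nonneg_iff.mp (p.map_nonneg ha)
  ⟨h.2.symm, h.1⟩

theorem re_mono (p : A →ₚ[ℂ] ℂ) {a b : A} (h : a ≤ b) : (p a).re ≤ (p b).re :=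
  (OrderHomClass.mono p h).1

variable [StarOrderedRing A]

/-- Cauchy–Schwarz inequality for positive functionals. -/
theorem norm_apply_star_mul_le (p : A →ₚ[ℂ] ℂ) (a b : A) :
    ‖p (star a * b)‖ ≤ √(p (star a * a)).re * √(p (star b * b)).re :=
  norm_inner_le_norm (𝕜 := ℂ) (p.toPreGNS a) (p.toPreGNS b)

theorem re_apply_star_mul_self_le (p : A →ₚ[ℂ] ℂ) (a : A) :
    (p (star a * a)).re ≤ ‖a‖ ^ 2 * (p 1).re := by
  refine (p.re_mono CStarAlgebra.star_mul_le_algebraMap_norm_sq).trans_eq ?_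
  rw [Algebra.algebraMap_eq_smul_one, ← Complex.coe_smul, map_smul]
  have h : ((‖a‖ : ℂ) ^ 2).im = 0 := by rw [← Complex.ofReal_pow, Complex.ofReal_im]
  have h' : ((‖a‖ : ℂ) ^ 2).re = ‖a‖ ^ 2 := by rw [← Complex.ofReal_pow, Complex.ofReal_re]
  simp [h, h']

theorem re_apply_one_nonneg (p : A →ₚ[ℂ] ℂ) : 0 ≤ (p 1).re :=
  (p.map_nonneg zero_le_one).1

theorem norm_apply_le (p : A →ₚ[ℂ] ℂ) (a : A) : ‖p a‖ ≤ (p 1).re * ‖a‖ := by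
  have h := p.norm_apply_star_mul_le 1 a
  simp only [star_one, one_mul] at h
  calc ‖p a‖ ≤ √(p 1).re * √(p (star a * a)).re := h
    _ ≤ √(p 1).re * √(‖a‖ ^ 2 * (p 1).re) := by
      gcongr; exact p.re_apply_star_mul_self_le a
    _ = (p 1).re * ‖a‖ := by
      rw [Real.sqrt_mul (by positivity), Real.sqrt_sq (norm_nonneg a)]
      linear_combination ‖a‖ * Real.mul_self_sqrt p.re_apply_one_nonneg

theorem norm_apply_mul_le (p : A →ₚ[ℂ] ℂ) {k : A} (hk₀ : 0 ≤ k) (hk₁ : k ≤ 1) (x : A) :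
    ‖p (k * x)‖ ≤ √((p k).re * (p 1).re) * ‖x‖ := by
  have h := p.norm_apply_star_mul_le k x
  rw [(IsSelfAdjoint.of_nonneg hk₀).star_eq] at h
  have hk : k * k ≤ k := by
    simpa [pow_two] using CStarAlgebra.pow_antitone hk₀ hk₁ one_le_two
  have hk' : 0 ≤ (p k).re := (p.map_nonneg hk₀).1
  calc ‖p (k * x)‖ ≤ √(p (k * k)).re * √(p (star x * x)).re := h
    _ ≤ √(p k).re * √((p 1).re * ‖x‖ ^ 2) := by
      refine mul_le_mul (Real.sqrt_le_sqrt (p.re_mono hk)) (Real.sqrt_le_sqrt ?_)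
        (Real.sqrt_nonneg _) (Real.sqrt_nonneg _)
      rw [mul_comm]; exact p.re_apply_star_mul_self_le x
    _ = √((p k).re * (p 1).re) * ‖x‖ := by
      rw [Real.sqrt_mul p.re_apply_one_nonneg, Real.sqrt_sq (norm_nonneg x),
        Real.sqrt_mul hk', mul_assoc]

theorem exists_of_nonneg_on_selfAdjoint (g : selfAdjoint A →ₗ[ℝ] ℝ)
    (hg : ∀ x : selfAdjoint A, 0 ≤ (x : A) → 0 ≤ g x) :
    ∃ p : A →ₚ[ℂ] ℂ, ∀ a, (p a).re = g (realPart a) := by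
  let P : A →ₗ[ℂ] ℂ := Module.Dual.extendRCLike (g ∘ₗ realPart)
  have hre (a : A) : (P a).re = g (realPart a) :=
    Module.Dual.re_extendRCLike_apply (𝕜 := ℂ) (g ∘ₗ realPart) a
  have him (a : A) : (P a).im = g (imaginaryPart a) := by
    refine (Module.Dual.im_extendRCLike_apply (𝕜 := ℂ) (g ∘ₗ realPart) a).trans ?_
    simp [realPart_I_smul]
  refine ⟨mk₀ P fun a ha ↦ ?_, hre⟩
  obtain ⟨h₁, h₂⟩ := nonneg_iff_realPart_imaginaryPart.mp ha
  refine Complex.nonneg_iff.mpr ⟨?_, ?_⟩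
  · rw [hre]; exact hg _ h₁
  · rw [him, h₂, map_zero]

end PositiveLinearMap

variable [StarOrderedRing A]

/-- If `f = p - q` and `k` almost separates `p` from `q`, then `p` is close to `f (k * ·)`. -/
theorem norm_sub_apply_mul_le {f : A → ℂ} {p q : A →ₚ[ℂ] ℂ} (hf : ∀ a, f a = p a - q a)
    {k : A} (hk₀ : 0 ≤ k) (hk₁ : k ≤ 1) {ε N : ℝ}
    (hε : (p (1 - k)).re + (q k).re ≤ ε) (hN : (p 1).re + (q 1).re ≤ N) (x : A) :
    ‖p x - f (k * x)‖ ≤ 2 * √(ε * N) * ‖x‖ := by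
  have hp₁ := p.re_apply_one_nonneg
  have hq₁ := q.re_apply_one_nonneg
  have hpk : 0 ≤ (p (1 - k)).re := (p.map_nonneg (sub_nonneg.mpr hk₁)).1
  have hqk : 0 ≤ (q k).re := (q.map_nonneg hk₀).1
  have hp := p.norm_apply_mul_le (sub_nonneg.mpr hk₁) (sub_le_self 1 hk₀) x
  have hq := q.norm_apply_mul_le hk₀ hk₁ x
  have key : p x - f (k * x) = p ((1 - k) * x) + q (k * x) := by
    rw [hf, sub_mul, one_mul, map_sub]; ring
  calc ‖p x - f (k * x)‖ ≤ ‖p ((1 - k) * x)‖ + ‖q (k * x)‖ := by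
        rw [key]; exact norm_add_le _ _
    _ ≤ √((p (1 - k)).re * (p 1).re) * ‖x‖ + √((q k).re * (q 1).re) * ‖x‖ := add_le_add hp hq
    _ ≤ √(ε * N) * ‖x‖ + √(ε * N) * ‖x‖ := by
      gcongr <;> linarith
    _ = 2 * √(ε * N) * ‖x‖ := by ring

theorem neg_norm_mul_le_re_of_smul_one_bounds (f : A →L[ℂ] ℂ) {x : A} {s : ℝ}
    (h₁ : 0 ≤ x + s • (1 : A)) (h₂ : 0 ≤ -x + s • (1 : A)) : 0 ≤ (f x).re + ‖f‖ * s := by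
  rcases subsingleton_or_nontrivial A with hA | hA
  · have hf : f = 0 := by ext a; rw [Subsingleton.elim a 0]; simp
    simp [hf]
  have hx : IsSelfAdjoint x := by
    have h := (IsSelfAdjoint.of_nonneg h₁).sub (IsSelfAdjoint.smul (.all s) (.one A))
    simpa using h
  have hlow : algebraMap ℝ A (-s) ≤ x := by
    rw [map_neg, Algebra.algebraMap_eq_smul_one]
    exact neg_le_iff_add_nonneg.mpr h₁
  have hupp : x ≤ algebraMap ℝ A s := by
    rw [Algebra.algebraMap_eq_smul_one]
    exact sub_nonneg.mp (by rwa [sub_eq_neg_add])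
  have hnorm : ‖x‖ ≤ s := by
    rcases CStarAlgebra.norm_or_neg_norm_mem_spectrum hx with h | h
    · exact (le_algebraMap_iff_spectrum_le hx).mp hupp _ h
    · exact neg_le_neg_iff.mp ((algebraMap_le_iff_le_spectrum hx).mp hlow _ h)
  have := (abs_le.mp ((Complex.abs_re_le_norm _).trans (f.le_opNorm x))).1
  have := mul_le_mul_of_nonneg_left hnorm (norm_nonneg f)
  linarith

/-- The Jordan decomposition of a hermitian functional. -/
theorem exists_jordan_decomposition (f : A →L[ℂ] ℂ) (hf : ∀ a, f (star a) = star (f a)) :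
    ∃ p q : A →ₚ[ℂ] ℂ, (∀ a, f a = p a - q a) ∧ (p 1).re + (q 1).re ≤ ‖f‖ := by
  let C : PointedCone ℝ (selfAdjoint A × selfAdjoint A × ℝ) :=
    { carrier := {v | 0 ≤ (v.1 : A) + v.2.2 • (1 : A) ∧ 0 ≤ (v.2.1 : A) + v.2.2 • (1 : A)}
      add_mem' := by
        rintro v w ⟨hv₁, hv₂⟩ ⟨hw₁, hw₂⟩
        constructor
        · convert add_nonneg hv₁ hw₁ using 1
          simp [add_smul]; abel
        · convert add_nonneg hv₂ hw₂ using 1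
          simp [add_smul]; abel
      zero_mem' := by simp
      smul_mem' := by
        rintro ⟨c, hc⟩ v ⟨hv₁, hv₂⟩
        constructor
        · convert smul_nonneg hc hv₁ using 1
          simp [smul_smul]
        · convert smul_nonneg hc hv₂ using 1
          simp [smul_smul] }
  have hC (v) : v ∈ C ↔ 0 ≤ (v.1 : A) + v.2.2 • (1 : A) ∧ 0 ≤ (v.2.1 : A) + v.2.2 • (1 : A) :=
    Iff.rfl
  let D : Submodule ℝ (selfAdjoint A × selfAdjoint A × ℝ) :=
    { carrier := {v | v.2.1 = -v.1}
      add_mem' := by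
        intro v w hv hw
        simp only [Set.mem_ofPred_eq, Prod.fst_add, Prod.snd_add] at *
        rw [hv, hw]; abel
      zero_mem' := by simp
      smul_mem' := by
        intro c v hv
        simp only [Set.mem_ofPred_eq, Prod.smul_fst, Prod.smul_snd] at *
        rw [hv, smul_neg] }
  let F : selfAdjoint A × selfAdjoint A × ℝ →ₗ[ℝ] ℝ :=
    { toFun v := (f v.1).re + ‖f‖ * v.2.2
      map_add' v w := by simp; ring
      map_smul' c v := by
        have : f (c • (v.1 : A)) = c • f v.1 := by
          rw [← Complex.coe_smul, map_smul, Complex.coe_smul]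
        simp [this]; ring }
  obtain ⟨G, hG, hGpos⟩ := riesz_extension C ⟨D, F ∘ₗ D.subtype⟩
    (by
      rintro ⟨⟨x, y, s⟩, hy⟩ ⟨h₁, h₂⟩
      obtain rfl : y = -x := hy
      exact neg_norm_mul_le_re_of_smul_one_bounds f h₁ (by simpa using h₂))
    (by
      rintro ⟨x, y, s⟩
      refine ⟨⟨(0, 0, ‖x‖ + ‖y‖ - s), by simp [D]⟩, (hC _).mpr ?_⟩
      have h (z : selfAdjoint A) : 0 ≤ (z : A) + ‖z‖ • (1 : A) := by
        have := z.2.neg_algebraMap_norm_le_self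
        rw [Algebra.algebraMap_eq_smul_one] at this
        exact neg_le_iff_add_nonneg.mp this
      have h' (z : selfAdjoint A) : 0 ≤ ‖z‖ • (1 : A) := smul_nonneg (norm_nonneg z) zero_le_one
      constructor
      · convert add_nonneg (h x) (h' y) using 1
        simp [add_smul]; abel
      · convert add_nonneg (h y) (h' x) using 1
        simp [add_smul]; abel)
  have hGD (x : selfAdjoint A) (s : ℝ) : G (x, -x, s) = (f x).re + ‖f‖ * s :=
    hG ⟨(x, -x, s), rfl⟩
  obtain ⟨p, hp⟩ := PositiveLinearMap.exists_of_nonneg_on_selfAdjoint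
    (G ∘ₗ LinearMap.inl ℝ _ _) fun x hx ↦ hGpos _ ((hC _).mpr (by simpa using hx))
  obtain ⟨q, hq⟩ := PositiveLinearMap.exists_of_nonneg_on_selfAdjoint
    (G ∘ₗ LinearMap.inr ℝ _ _ ∘ₗ LinearMap.inl ℝ _ _)
    fun x hx ↦ hGpos _ ((hC _).mpr (by simpa using hx))
  have hre (a : A) : (f a).re = (p a).re - (q a).re := by
    have h := hGD (realPart a) 0
    rw [mul_zero, add_zero, re_apply_realPart f hf] at h
    rw [hp, hq, ← h]
    simp [← map_sub]
  refine ⟨p, q, fun a ↦ ?_, ?_⟩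
  · apply Complex.ext
    · simp [hre]
    · have := hre (Complex.I • a)
      simp at this
      simp; linarith
  · have h : 0 ≤ G (-1, -1, 1) := hGpos _ ((hC _).mpr (by simp))
    have h₀ : G (0, 0, 1) = ‖f‖ := by simpa using hGD 0 1
    have : G (-1, -1, 1) = G (0, 0, 1) - G (1, 0, 0) - G (0, 1, 0) := by simp [← map_sub]
    rw [hp, hq, realPart_one]
    change G (1, 0, 0) + G (0, 1, 0) ≤ ‖f‖
    linarith

end PositiveFunctional

/-- Lemma 2, existence of the Jordan decomposition.  Let `A` be a
unital C*-algebra, `X` a compact Hausdorff space and `φ : A → C(X, ℂ)` a self-adjoint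
absolutely continuous bounded linear map (the pointwise norm function `t ↦ ‖φ_t‖` is
continuous).  Then `φ` is a difference `φ = φ₊ - φ₋` of two positive linear maps with
`‖φ_t‖ = ‖(φ₊)_t‖ + ‖(φ₋)_t‖` for every `t`. -/
theorem stmt2
    {A : Type*} [CStarAlgebra A] [PartialOrder A] [StarOrderedRing A]
    {X : Type*} [TopologicalSpace X] [CompactSpace X] [T2Space X]
    (φ : A →L[ℂ] C(X, ℂ))
    (hsa : ∀ a : A, φ (star a) = star (φ a))
    (hac : Continuous fun t : X => ‖fiberFunctional φ t‖) :
    ∃ φp φm : A →L[ℂ] C(X, ℂ), IsPosMap φp ∧ IsPosMap φm ∧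
      φ = φp - φm ∧
      ∀ t : X, ‖fiberFunctional φ t‖ =
        ‖fiberFunctional φp t‖ + ‖fiberFunctional φm t‖ := by
  have hφ (t : X) (a : A) : fiberFunctional φ t a = φ a t := rfl
  have hφsa (t : X) (a : A) : fiberFunctional φ t (star a) = star (fiberFunctional φ t a) := by
    simp [hφ, hsa]
  have hφle (t : X) : ‖fiberFunctional φ t‖ ≤ ‖φ‖ :=
    ContinuousLinearMap.opNorm_le_bound _ (norm_nonneg φ) fun a ↦
      ((φ a).norm_coe_le_norm t).trans (φ.le_opNorm a)
  choose p q hpq hnorm using fun t ↦ exists_jordan_decomposition (fiberFunctional φ t) (hφsa t)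
  have hcont (x : A) : Continuous fun t ↦ p t x := by
    refine continuous_of_forall_eventually_dist_le fun t₀ ε hε ↦ ?_
    obtain ⟨δ, hδ, hδε⟩ : ∃ δ > 0, 2 * √(δ * ‖φ‖) * ‖x‖ ≤ ε := by
      have hlim : Filter.Tendsto (fun δ : ℝ ↦ 2 * √(δ * ‖φ‖) * ‖x‖) (nhdsWithin 0 (Set.Ioi 0))
          (nhds 0) := by
        have : Continuous fun δ : ℝ ↦ 2 * √(δ * ‖φ‖) * ‖x‖ := by fun_prop
        simpa using (this.tendsto 0).mono_left nhdsWithin_le_nhds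
      obtain ⟨δ, hδ, hδ'⟩ := ((hlim.eventually_le_const hε).and self_mem_nhdsWithin).exists
      exact ⟨δ, hδ', hδ⟩
    obtain ⟨a, ha, ha₁, hlt⟩ := exists_selfAdjoint_lt_re_apply (fiberFunctional φ t₀) (hφsa t₀)
      (sub_lt_self ‖fiberFunctional φ t₀‖ hδ)
    have haup : a ≤ 1 := by
      refine ha.le_algebraMap_norm_self.trans ?_
      simpa using algebraMap_mono A ha₁
    have halow : -1 ≤ a := by
      refine le_trans ?_ ha.neg_algebraMap_norm_le_self
      simpa using algebraMap_mono A ha₁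
    let k : A := (2⁻¹ : ℝ) • (1 + a)
    have hk : 1 - k = (2⁻¹ : ℝ) • (1 - a) := by
      simp only [k, smul_add, smul_sub]
      nth_rw 1 [show (1 : A) = (2⁻¹ : ℝ) • 1 + (2⁻¹ : ℝ) • 1 by rw [← add_smul]; norm_num]
      abel
    have hk₀ : 0 ≤ k := smul_nonneg (by norm_num) (neg_le_iff_add_nonneg'.mp halow)
    have hk₁ : k ≤ 1 := sub_nonneg.mp (hk ▸ smul_nonneg (by norm_num) (sub_nonneg.mpr haup))
    refine ⟨fun t ↦ φ (k * x) t, (φ (k * x)).continuous, ?_⟩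
    have hev : ∀ᶠ t in nhds t₀, ‖fiberFunctional φ t‖ - δ < (φ a t).re :=
      (hac.sub continuous_const).continuousAt.eventually_lt
        (Complex.continuous_re.comp (φ a).continuous).continuousAt hlt
    filter_upwards [hev] with t ht
    rw [dist_eq_norm]
    refine (norm_sub_apply_mul_le (hpq t) hk₀ hk₁ ?_ ((hnorm t).trans (hφle t)) x).trans hδε
    have hkp : (p t (1 - k)).re = 2⁻¹ * ((p t 1).re - (p t a).re) := by
      rw [hk, ← Complex.coe_smul, map_smul]; simp
    have hkq : (q t k).re = 2⁻¹ * ((q t 1).re + (q t a).re) := by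
      simp only [k]; rw [← Complex.coe_smul, map_smul]; simp
    have hre : (φ a t).re = (p t a).re - (q t a).re := by
      rw [← hφ, hpq, Complex.sub_re]
    linarith [hnorm t]
  have hple (t : X) : (p t 1).re ≤ ‖φ‖ := by
    linarith [hnorm t, hφle t, (q t).re_apply_one_nonneg]
  let φp : A →L[ℂ] C(X, ℂ) := LinearMap.mkContinuous
    { toFun x := ⟨fun t ↦ p t x, hcont x⟩
      map_add' x y := by ext t; simp
      map_smul' c x := by ext t; simp } ‖φ‖ fun x ↦
    (ContinuousMap.norm_le _ (by positivity)).mpr fun t ↦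
      ((p t).norm_apply_le x).trans (by gcongr; exact hple t)
  have hφp (x : A) (t : X) : φp x t = p t x := rfl
  have hφm (x : A) (t : X) : (φp - φ) x t = q t x := by
    have := hpq t x
    rw [hφ] at this
    simp [hφp, this]
  refine ⟨φp, φp - φ, fun a ha t ↦ ?_, fun a ha t ↦ ?_, by abel, fun t ↦ le_antisymm ?_ ?_⟩
  · exact (p t).im_eq_zero_and_re_nonneg ha
  · rw [hφm]
    exact (q t).im_eq_zero_and_re_nonneg ha
  · have : fiberFunctional φ t = fiberFunctional φp t - fiberFunctional (φp - φ) t := by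
      ext a; simp [fiberFunctional]
    rw [this]
    exact norm_sub_le _ _
  · refine le_trans (add_le_add ?_ ?_) (hnorm t)
    · exact ContinuousLinearMap.opNorm_le_bound _ (p t).re_apply_one_nonneg (p t).norm_apply_le
    · refine ContinuousLinearMap.opNorm_le_bound _ (q t).re_apply_one_nonneg fun x ↦ ?_
      exact (congrArg norm (hφm x t)).trans_le ((q t).norm_apply_le x)
end

section
/- Let A be a commutative unital C*-algebra, X a compact Hausdorff space, and φ : A → C(X,ℂ) a self-adjoint absolutely continuous linear map. Then for every h ∈ A with h ≥ 0, the function t ↦ sup{ φ(g)(t) : g ∈ A, 0 ≤ g ≤ h } (whose values are real since φ is self-adjoint) is continuous on X. -/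
section PositivePart

variable {A : Type*} [CommCStarAlgebra A] [PartialOrder A]

/-- The values on positive elements `h` of the positive part of the Jordan decomposition
of the real part of a functional. -/
noncomputable def jordanPosPart (f : A →L[ℂ] ℂ) (h : A) : ℝ :=
  sSup {r : ℝ | ∃ g : A, 0 ≤ g ∧ g ≤ h ∧ r = (f g).re}

theorem jordanPosPart_le (f : A →L[ℂ] ℂ) {h : A} (hh : 0 ≤ h) {c : ℝ}
    (hc : ∀ g : A, 0 ≤ g → g ≤ h → (f g).re ≤ c) : jordanPosPart f h ≤ c := by
  refine csSup_le ⟨_, 0, le_rfl, hh, rfl⟩ ?_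
  rintro _ ⟨g, hg, hgh, rfl⟩
  exact hc g hg hgh

theorem exists_lt_re_of_lt_jordanPosPart (f : A →L[ℂ] ℂ) {h : A} (hh : 0 ≤ h) {c : ℝ}
    (hc : c < jordanPosPart f h) : ∃ g : A, 0 ≤ g ∧ g ≤ h ∧ c < (f g).re := by
  by_contra! hcon
  exact hc.not_ge (jordanPosPart_le f hh hcon)

variable [StarOrderedRing A]

theorem CFC.posPart_le_of_le_of_nonneg {d b : A} (hd : IsSelfAdjoint d) (hb : 0 ≤ b)
    (hdb : d ≤ b) : d⁺ ≤ b := by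
  have hnn : 0 ≤ (2 : ℝ) • b - d := by
    rw [two_smul, add_sub_assoc]
    exact add_nonneg hb (sub_nonneg.2 hdb)
  have hsq : star d * d ≤ ((2 : ℝ) • b - d) * ((2 : ℝ) • b - d) := by
    rw [hd.star_eq, ← sub_nonneg]
    have h4 : 0 ≤ (4 : ℝ) • (b * (b - d)) :=
      smul_nonneg (by norm_num) ((Commute.all _ _).mul_nonneg hb (sub_nonneg.2 hdb))
    convert h4 using 1
    simp only [ofNat_smul_eq_nsmul, nsmul_eq_mul]
    push_cast
    ring
  have habs : CFC.abs d ≤ (2 : ℝ) • b - d := by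
    have := CFC.sqrt_le_sqrt _ _ hsq
    rwa [CFC.sqrt_mul_self _ hnn] at this
  have h2 : (2 : ℝ) • d⁺ ≤ (2 : ℝ) • b := by
    have := CFC.abs_add_self d hd
    rw [ofNat_smul_eq_nsmul, ← this]
    simpa using! add_le_add_left habs d
  have := smul_le_smul_of_nonneg_left h2 (show (0 : ℝ) ≤ 2⁻¹ by norm_num)
  simpa [smul_smul] using this

/-- The Riesz decomposition property of the self-adjoint part of a commutative C⋆-algebra. -/
theorem CommCStarAlgebra.exists_add_eq_of_le_add {g h k : A} (hg : 0 ≤ g) (hh : 0 ≤ h)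
    (hk : 0 ≤ k) (hgk : g ≤ h + k) :
    ∃ g₁ g₂ : A, (0 ≤ g₁ ∧ g₁ ≤ h) ∧ (0 ≤ g₂ ∧ g₂ ≤ k) ∧ g₁ + g₂ = g := by
  have hd : IsSelfAdjoint (g - h) := (IsSelfAdjoint.of_nonneg hg).sub (.of_nonneg hh)
  refine ⟨g - (g - h)⁺, (g - h)⁺, ⟨?_, ?_⟩, ⟨CFC.posPart_nonneg _, ?_⟩, sub_add_cancel _ _⟩
  · exact sub_nonneg.2 (CFC.posPart_le_of_le_of_nonneg hd hg (sub_le_self _ hh))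
  · rw [sub_le_comm]
    exact CFC.le_posPart hd
  · exact CFC.posPart_le_of_le_of_nonneg hd hk (sub_le_iff_le_add'.2 hgk)

theorem bddAbove_jordanPosPart (f : A →L[ℂ] ℂ) (h : A) :
    BddAbove {r : ℝ | ∃ g : A, 0 ≤ g ∧ g ≤ h ∧ r = (f g).re} := by
  refine ⟨‖f‖ * ‖h‖, ?_⟩
  rintro _ ⟨g, hg, hgh, rfl⟩
  calc (f g).re ≤ ‖f g‖ := Complex.re_le_norm _
    _ ≤ ‖f‖ * ‖g‖ := f.le_opNorm g
    _ ≤ ‖f‖ * ‖h‖ := by gcongr; exact CStarAlgebra.norm_le_norm_of_nonneg_of_le hg hgh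

theorem re_le_jordanPosPart (f : A →L[ℂ] ℂ) {g h : A} (hg : 0 ≤ g) (hgh : g ≤ h) :
    (f g).re ≤ jordanPosPart f h :=
  le_csSup (bddAbove_jordanPosPart f h) ⟨g, hg, hgh, rfl⟩

theorem jordanPosPart_add (f : A →L[ℂ] ℂ) {h k : A} (hh : 0 ≤ h) (hk : 0 ≤ k) :
    jordanPosPart f (h + k) = jordanPosPart f h + jordanPosPart f k := by
  apply le_antisymm
  · refine jordanPosPart_le f (add_nonneg hh hk) fun g hg hgk => ?_
    obtain ⟨g₁, g₂, ⟨h₁, h₁'⟩, ⟨h₂, h₂'⟩, rfl⟩ :=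
      CommCStarAlgebra.exists_add_eq_of_le_add hg hh hk hgk
    rw [map_add, Complex.add_re]
    exact add_le_add (re_le_jordanPosPart f h₁ h₁') (re_le_jordanPosPart f h₂ h₂')
  · rw [← le_sub_iff_add_le]
    refine jordanPosPart_le f hh fun g₁ h₁ h₁' => ?_
    rw [le_sub_comm]
    refine jordanPosPart_le f hk fun g₂ h₂ h₂' => ?_
    rw [le_sub_iff_add_le', ← Complex.add_re, ← map_add]
    exact re_le_jordanPosPart f (add_nonneg h₁ h₂) (add_le_add h₁' h₂')

theorem norm_two_smul_sub_algebraMap_le {g : A} {c : ℝ} (hc : 0 ≤ c) (hg : 0 ≤ g)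
    (hgc : g ≤ algebraMap ℝ A c) : ‖(2 : ℝ) • g - algebraMap ℝ A c‖ ≤ c := by
  have hcsa : IsSelfAdjoint (algebraMap ℝ A c) := .algebraMap A (.all c)
  have hsa : IsSelfAdjoint ((2 : ℝ) • g - algebraMap ℝ A c) :=
    (IsSelfAdjoint.smul (.all _) (.of_nonneg hg)).sub hcsa
  have h4 : 0 ≤ (4 : ℝ) • (g * (algebraMap ℝ A c - g)) :=
    smul_nonneg (by norm_num) ((Commute.all _ _).mul_nonneg hg (sub_nonneg.2 hgc))
  have hle : star ((2 : ℝ) • g - algebraMap ℝ A c) * ((2 : ℝ) • g - algebraMap ℝ A c) ≤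
      algebraMap ℝ A (c * c) := by
    rw [hsa.star_eq, ← sub_nonneg]
    convert h4 using 1
    simp only [ofNat_smul_eq_nsmul, nsmul_eq_mul, map_mul]
    push_cast
    ring
  have := (CStarAlgebra.norm_le_iff_le_algebraMap _ (mul_nonneg hc hc)
    (star_mul_self_nonneg _)).2 hle
  rw [CStarRing.norm_star_mul_self] at this
  exact abs_le_of_sq_le_sq' (by nlinarith) hc |>.2

theorem jordanPosPart_algebraMap (f : A →L[ℂ] ℂ) (hf : ∀ a, f (star a) = star (f a))
    {c : ℝ} (hc : 0 < c) :
    jordanPosPart f (algebraMap ℝ A c) = c * (‖f‖ + (f 1).re) / 2 := by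
  have hre (r : ℝ) (a : A) : (f (r • a)).re = r * (f a).re := by
    rw [← Complex.coe_smul, map_smul]; simp
  have hc0 : 0 ≤ algebraMap ℝ A c := by
    rw [Algebra.algebraMap_eq_smul_one]; exact smul_nonneg hc.le zero_le_one
  have hfc : (f (algebraMap ℝ A c)).re = c * (f 1).re := by
    rw [Algebra.algebraMap_eq_smul_one, hre]
  apply le_antisymm
  · refine jordanPosPart_le f hc0 fun g hg hgc => ?_
    have h1 := (Complex.re_le_norm _).trans (f.le_opNorm ((2 : ℝ) • g - algebraMap ℝ A c))
    have h2 := mul_le_mul_of_nonneg_left (norm_two_smul_sub_algebraMap_le hc.le hg hgc)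
      (norm_nonneg f)
    rw [map_sub, Complex.sub_re, hfc, hre] at h1
    linarith
  · have hsa (b : A) (hb : IsSelfAdjoint b) (hbc : ‖b‖ ≤ c) :
        (f b).re ≤ 2 * jordanPosPart f (algebraMap ℝ A c) - c * (f 1).re := by
      have hmono : algebraMap ℝ A ‖b‖ ≤ algebraMap ℝ A c := algebraMap_mono A hbc
      have h1 : b ≤ algebraMap ℝ A c := hb.le_algebraMap_norm_self.trans hmono
      have h2 : -algebraMap ℝ A c ≤ b := (neg_le_neg hmono).trans hb.neg_algebraMap_norm_le_self
      have h3 : 0 ≤ (2⁻¹ : ℝ) • (b + algebraMap ℝ A c) :=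
        smul_nonneg (by norm_num) (neg_le_iff_add_nonneg.1 h2)
      have h4 : (2⁻¹ : ℝ) • (b + algebraMap ℝ A c) ≤ algebraMap ℝ A c := by
        have := smul_le_smul_of_nonneg_left (add_le_add_left h1 (algebraMap ℝ A c))
          (show (0 : ℝ) ≤ 2⁻¹ by norm_num)
        rwa [← two_smul ℝ (algebraMap ℝ A c), smul_smul, inv_mul_cancel₀ two_ne_zero,
          one_smul] at this
      have h5 := re_le_jordanPosPart f h3 h4
      rw [hre, map_add, Complex.add_re, hfc] at h5
      linarith
    have hM0 : 0 ≤ 2 * jordanPosPart f (algebraMap ℝ A c) - c * (f 1).re := by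
      simpa using hsa 0 (.zero A) (by simpa using hc.le)
    have hball (a : A) (hac : ‖a‖ ≤ c) :
        ‖f a‖ ≤ 2 * jordanPosPart f (algebraMap ℝ A c) - c * (f 1).re := by
      obtain ⟨u, hu, hua⟩ : ∃ u : ℂ, ‖u‖ = 1 ∧ (‖f a‖ : ℂ) = u * f a := by
        obtain h0 | h0 := eq_or_ne (f a) 0
        · exact ⟨1, by simp, by simp [h0]⟩
        · have hn : (‖f a‖ : ℂ) ≠ 0 := by simpa using h0
          refine ⟨‖f a‖ / f a, by simp [h0], by field_simp⟩
      have key := hsa (realPart (u • a)) (realPart (u • a)).2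
        ((realPart.norm_le (u • a)).trans (by rwa [norm_smul, hu, one_mul]))
      have : (f (realPart (u • a))).re = ‖f a‖ := by
        rw [realPart_apply_coe, hre, map_add, hf, map_smul, smul_eq_mul, ← hua]
        simp
        ring
      rwa [this] at key
    have hnorm : ‖f‖ ≤ (2 * jordanPosPart f (algebraMap ℝ A c) - c * (f 1).re) / c := by
      refine f.opNorm_le_bound (div_nonneg hM0 hc.le) fun a => ?_
      obtain rfl | ha := eq_or_ne a 0
      · simp
      have han : 0 < ‖a‖ := norm_pos_iff.2 ha
      have := hball (((c / ‖a‖ : ℝ) : ℂ) • a) (by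
        rw [norm_smul, Complex.norm_real, Real.norm_of_nonneg (by positivity),
          div_mul_cancel₀ _ han.ne'])
      rw [map_smul, norm_smul, Complex.norm_real, Real.norm_of_nonneg (by positivity),
        div_mul_eq_mul_div, div_le_iff₀ han] at this
      rw [div_mul_eq_mul_div, le_div_iff₀ hc]
      linarith
    rw [le_div_iff₀ hc] at hnorm
    linarith

end PositivePart

theorem lowerSemicontinuous_jordanPosPart {A : Type*} [CommCStarAlgebra A] [PartialOrder A]
    [StarOrderedRing A] {X : Type*} [TopologicalSpace X] [CompactSpace X]
    (φ : A →L[ℂ] C(X, ℂ)) {h : A} (hh : 0 ≤ h) :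
    LowerSemicontinuous fun t : X => jordanPosPart (fiberFunctional φ t) h := by
  intro t y hy
  obtain ⟨g, hg, hgh, hyg⟩ := exists_lt_re_of_lt_jordanPosPart _ hh hy
  have hcont : Continuous fun s : X => (φ g s).re := by fun_prop
  filter_upwards [hcont.continuousAt.eventually_const_lt hyg] with s hs
  exact lt_of_lt_of_le hs (re_le_jordanPosPart (fiberFunctional φ s) hg hgh)

/-- Lemma 2, commutative case.  Let `A` be a commutative unital
C*-algebra, `X` a compact Hausdorff space and `φ : A → C(X, ℂ)` a self-adjoint
absolutely continuous bounded linear map.  Then for every `0 ≤ h` in `A` the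
pointwise positive Jordan part `t ↦ sup {φ(g)(t) : 0 ≤ g ≤ h}` (whose values are
real since `φ` is self-adjoint) is continuous on `X`. -/
theorem stmt4
    {A : Type*} [CommCStarAlgebra A] [PartialOrder A] [StarOrderedRing A]
    {X : Type*} [TopologicalSpace X] [CompactSpace X] [T2Space X]
    (φ : A →L[ℂ] C(X, ℂ))
    (hsa : ∀ a : A, φ (star a) = star (φ a))
    (hac : Continuous fun t : X => ‖fiberFunctional φ t‖)
    (h : A) (hh : 0 ≤ h) :
    Continuous fun t : X =>
      sSup {r : ℝ | ∃ g : A, 0 ≤ g ∧ g ≤ h ∧ r = (φ g t).re} := by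
  change Continuous fun t : X => jordanPosPart (fiberFunctional φ t) h
  set c : ℝ := ‖h‖ + 1 with hcdef
  have hc : 0 < c := by positivity
  have hk : 0 ≤ algebraMap ℝ A c - h :=
    sub_nonneg.2 ((IsSelfAdjoint.of_nonneg hh).le_algebraMap_norm_self.trans
      (algebraMap_mono A (by simp [hcdef])))
  have hF : Continuous fun t : X =>
      c * (‖fiberFunctional φ t‖ + (fiberFunctional φ t 1).re) / 2 := by
    have : Continuous fun t : X => (φ 1 t).re := by fun_prop
    exact ((hac.add this).const_mul c).div_const 2
  have heq : (fun t : X => jordanPosPart (fiberFunctional φ t) h) = fun t =>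
      c * (‖fiberFunctional φ t‖ + (fiberFunctional φ t 1).re) / 2 +
        -jordanPosPart (fiberFunctional φ t) (algebraMap ℝ A c - h) := by
    funext t
    have hsat (a : A) : fiberFunctional φ t (star a) = star (fiberFunctional φ t a) :=
      congrArg (fun u : C(X, ℂ) => u t) (hsa a)
    rw [← jordanPosPart_algebraMap _ hsat hc, ← sub_eq_add_neg, eq_sub_iff_add_eq,
      ← jordanPosPart_add _ hh hk, add_sub_cancel]
  refine continuous_iff_lower_upperSemicontinuous.2
    ⟨lowerSemicontinuous_jordanPosPart φ hh, ?_⟩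
  rw [heq]
  refine hF.upperSemicontinuous.add fun t y hy => ?_
  filter_upwards [lowerSemicontinuous_jordanPosPart φ hk t (-y) (by linarith)] with s hs
  linarith
end

section
/- Let A be a commutative unital C*-algebra and let φ₊, φ₋ : A → ℂ be positive linear functionals satisfying ‖φ₊ − φ₋‖ = ‖φ₊‖ + ‖φ₋‖. Let h ∈ A with 0 ≤ h ≤ 1 and define ψ : A → ℂ by ψ(x) = (φ₊ − φ₋)(hx). Then ‖ψ‖ = φ₊(h) + φ₋(h); moreover the functionals x ↦ φ₊(hx) and x ↦ φ₋(hx) are positive with norms φ₊(h) and φ₋(h) respectively, so that ψ = φ₊(h·) − φ₋(h·) is again a decomposition of ψ into positive functionals whose norms add up to ‖ψ‖. -/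
/-- A linear functional `f : A → ℂ` is positive if it takes nonnegative real
values on positive elements. -/
def IsPosFunctional {A : Type*} [CStarAlgebra A] [PartialOrder A]
    [StarOrderedRing A] (f : A →L[ℂ] ℂ) : Prop :=
  ∀ a : A, 0 ≤ a → (f a).im = 0 ∧ 0 ≤ (f a).re

section PositiveFunctionals

variable {A : Type*}

theorem IsPosFunctional.im_eq_zero_of_isSelfAdjoint [CStarAlgebra A] [PartialOrder A]
    [StarOrderedRing A] {f : A →L[ℂ] ℂ} (hf : IsPosFunctional f) {a : A}
    (ha : IsSelfAdjoint a) : (f a).im = 0 := by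
  have h1 := (hf _ (CFC.posPart_nonneg a)).1
  have h2 := (hf _ (CFC.negPart_nonneg a)).1
  rw [← CFC.posPart_sub_negPart a ha, map_sub, Complex.sub_im, h1, h2, sub_zero]

theorem IsPosFunctional.re_apply_le_of_isSelfAdjoint [CStarAlgebra A] [PartialOrder A]
    [StarOrderedRing A] {f : A →L[ℂ] ℂ} (hf : IsPosFunctional f) {a : A}
    (ha : IsSelfAdjoint a) : (f a).re ≤ (f 1).re * ‖a‖ := by
  have h1 := (hf _ (sub_nonneg.2 ha.le_algebraMap_norm_self)).2
  have h2 : algebraMap ℝ A ‖a‖ = ((‖a‖ : ℝ) : ℂ) • (1 : A) := by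
    rw [Algebra.algebraMap_eq_smul_one, Complex.coe_smul]
  rw [h2, map_sub, map_smul, Complex.sub_re, smul_eq_mul, Complex.re_ofReal_mul] at h1
  linarith

theorem IsPosFunctional.re_apply_le [CStarAlgebra A] [PartialOrder A]
    [StarOrderedRing A] {f : A →L[ℂ] ℂ} (hf : IsPosFunctional f) (a : A) :
    (f a).re ≤ (f 1).re * ‖a‖ := by
  have h_re : (f a).re = (f (realPart a : A)).re := by
    conv_lhs => rw [← realPart_add_I_smul_imaginaryPart a]
    simp [hf.im_eq_zero_of_isSelfAdjoint (imaginaryPart a).2]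
  rw [h_re]
  exact (hf.re_apply_le_of_isSelfAdjoint (realPart a).2).trans
    (mul_le_mul_of_nonneg_left (realPart.norm_le a) (hf 1 zero_le_one).2)

theorem IsPosFunctional.norm_eq_re_apply_one [CStarAlgebra A] [PartialOrder A]
    [StarOrderedRing A] {f : A →L[ℂ] ℂ} (hf : IsPosFunctional f) : ‖f‖ = (f 1).re := by
  apply le_antisymm
  · refine f.opNorm_le_bound (hf 1 zero_le_one).2 fun x ↦ ?_
    obtain ⟨c, hc, hcx⟩ := RCLike.exists_norm_eq_mul_self (f x)
    have h1 := hf.re_apply_le (c • x)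
    rwa [map_smul, smul_eq_mul, ← hcx, norm_smul, hc, one_mul, RCLike.ofReal_eq_complex_ofReal,
      Complex.ofReal_re] at h1
  · cases subsingleton_or_nontrivial A
    · simp [Subsingleton.elim (1 : A) 0]
    · have h1 := f.le_opNorm 1
      rw [CStarRing.norm_one, mul_one] at h1
      exact (Complex.re_le_norm _).trans h1

theorem IsPosFunctional.comp_mul [CommCStarAlgebra A] [PartialOrder A] [StarOrderedRing A]
    {f : A →L[ℂ] ℂ} (hf : IsPosFunctional f) {h : A} (hh : 0 ≤ h) :
    IsPosFunctional (f.comp (ContinuousLinearMap.mul ℂ A h)) :=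
  fun a ha ↦ hf (h * a) ((Commute.all h a).mul_nonneg hh ha)

theorem IsPosFunctional.norm_comp_mul [CommCStarAlgebra A] [PartialOrder A] [StarOrderedRing A]
    {f : A →L[ℂ] ℂ} (hf : IsPosFunctional f) {h : A} (hh : 0 ≤ h) :
    ‖f.comp (ContinuousLinearMap.mul ℂ A h)‖ = (f h).re := by
  simp [(hf.comp_mul hh).norm_eq_re_apply_one]

theorem IsPosFunctional.norm_sub_comp_mul_le [CommCStarAlgebra A] [PartialOrder A]
    [StarOrderedRing A] {f g : A →L[ℂ] ℂ} (hf : IsPosFunctional f) (hg : IsPosFunctional g)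
    {h : A} (hh : 0 ≤ h) :
    ‖(f - g).comp (ContinuousLinearMap.mul ℂ A h)‖ ≤ (f h).re + (g h).re := by
  rw [ContinuousLinearMap.sub_comp, ← hf.norm_comp_mul hh, ← hg.norm_comp_mul hh]
  exact norm_sub_le _ _

end PositiveFunctionals

/-- Let `A` be a commutative unital C*-algebra and `φ₊, φ₋`
positive linear functionals with `‖φ₊ - φ₋‖ = ‖φ₊‖ + ‖φ₋‖` (i.e. `φ₊ - φ₋` is the
Jordan decomposition of the hermitian functional `φ₊ - φ₋`).  For `0 ≤ h ≤ 1` let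
`ψ(x) = (φ₊ - φ₋)(h x)`.  Then `‖ψ‖ = φ₊(h) + φ₋(h)`; moreover `x ↦ φ₊(h x)` and
`x ↦ φ₋(h x)` are positive functionals of norms `φ₊(h)` and `φ₋(h)` respectively,
so `ψ = φ₊(h·) - φ₋(h·)` is a decomposition of `ψ` into positive functionals whose
norms add up to `‖ψ‖`. -/
theorem stmt5
    {A : Type*} [CommCStarAlgebra A] [PartialOrder A] [StarOrderedRing A]
    (φp φm : A →L[ℂ] ℂ)
    (hφp : IsPosFunctional φp) (hφm : IsPosFunctional φm)
    (hJordan : ‖φp - φm‖ = ‖φp‖ + ‖φm‖)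
    (h : A) (hh0 : 0 ≤ h) (hh1 : h ≤ 1) :
    ‖(φp - φm).comp (ContinuousLinearMap.mul ℂ A h)‖ = (φp h).re + (φm h).re ∧
    IsPosFunctional (φp.comp (ContinuousLinearMap.mul ℂ A h)) ∧
    IsPosFunctional (φm.comp (ContinuousLinearMap.mul ℂ A h)) ∧
    ‖φp.comp (ContinuousLinearMap.mul ℂ A h)‖ = (φp h).re ∧
    ‖φm.comp (ContinuousLinearMap.mul ℂ A h)‖ = (φm h).re ∧
    (φp - φm).comp (ContinuousLinearMap.mul ℂ A h) =
      φp.comp (ContinuousLinearMap.mul ℂ A h) -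
        φm.comp (ContinuousLinearMap.mul ℂ A h) := by
  refine ⟨le_antisymm (hφp.norm_sub_comp_mul_le hφm hh0) ?_, hφp.comp_mul hh0, hφm.comp_mul hh0,
    hφp.norm_comp_mul hh0, hφm.norm_comp_mul hh0, ContinuousLinearMap.sub_comp _ _ _⟩
  have h_compl := hφp.norm_sub_comp_mul_le hφm (sub_nonneg.2 hh1)
  have h_split : φp - φm = (φp - φm).comp (ContinuousLinearMap.mul ℂ A h) +
      (φp - φm).comp (ContinuousLinearMap.mul ℂ A (1 - h)) := by
    rw [← ContinuousLinearMap.comp_add, ← map_add, add_sub_cancel]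
    ext x
    simp
  have h_tri := norm_add_le ((φp - φm).comp (ContinuousLinearMap.mul ℂ A h))
    ((φp - φm).comp (ContinuousLinearMap.mul ℂ A (1 - h)))
  rw [← h_split, hJordan, hφp.norm_eq_re_apply_one, hφm.norm_eq_re_apply_one] at h_tri
  simp only [map_sub φp, map_sub φm, Complex.sub_re] at h_compl
  linarith
end

section
/- Let A be a commutative unital C*-algebra and let φ₊, φ₋ : A → ℂ be positive linear functionals satisfying ‖φ₊ − φ₋‖ = ‖φ₊‖ + ‖φ₋‖. Then for every ε > 0 there exists K ∈ A with 0 ≤ K ≤ 1 such that φ₊(K) ≤ ε and φ₋(1 − K) ≤ ε. -/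
lemma IsPosFunctional.im_apply_of_isSelfAdjoint {A : Type*} [CStarAlgebra A] [PartialOrder A]
    [StarOrderedRing A] {f : A →L[ℂ] ℂ} (hf : IsPosFunctional f) {a : A}
    (ha : IsSelfAdjoint a) : (f a).im = 0 := by
  have h1 : 0 ≤ algebraMap ℝ A ‖a‖ + a := by
    have := ha.neg_algebraMap_norm_le_self
    rwa [neg_le_iff_add_nonneg'] at this
  have h2 : 0 ≤ algebraMap ℝ A ‖a‖ := algebraMap_nonneg A (norm_nonneg a)
  have h3 := (hf _ h1).1
  rw [map_add, Complex.add_im, (hf _ h2).1, zero_add] at h3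
  exact h3

lemma IsPosFunctional.re_apply_realPart {A : Type*} [CStarAlgebra A] [PartialOrder A]
    [StarOrderedRing A] {f : A →L[ℂ] ℂ} (hf : IsPosFunctional f) (x : A) :
    (f (realPart x : A)).re = (f x).re := by
  have him := hf.im_apply_of_isSelfAdjoint (imaginaryPart x).2
  conv_rhs => rw [← realPart_add_I_smul_imaginaryPart x]
  simp [him]

lemma re_apply_one_le_norm {A : Type*} [CStarAlgebra A] [Nontrivial A] (f : A →L[ℂ] ℂ) :
    (f 1).re ≤ ‖f‖ :=
  (Complex.re_le_norm _).trans (by simpa using f.le_opNorm 1)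

/-- Let `A` be a commutative unital C*-algebra and `φ₊, φ₋`
positive linear functionals with `‖φ₊ - φ₋‖ = ‖φ₊‖ + ‖φ₋‖` (i.e. `φ₊ - φ₋` is the
Jordan decomposition of the hermitian functional `φ₊ - φ₋`).  Then for every
`ε > 0` there exists `K ∈ A` with `0 ≤ K ≤ 1`, `φ₊(K) ≤ ε` and `φ₋(1 - K) ≤ ε`. -/
theorem stmt6
    {A : Type*} [CommCStarAlgebra A] [PartialOrder A] [StarOrderedRing A]
    (φp φm : A →L[ℂ] ℂ)
    (hφp : IsPosFunctional φp) (hφm : IsPosFunctional φm)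
    (hJordan : ‖φp - φm‖ = ‖φp‖ + ‖φm‖)
    (ε : ℝ) (hε : 0 < ε) :
    ∃ K : A, 0 ≤ K ∧ K ≤ 1 ∧ (φp K).re ≤ ε ∧ (φm (1 - K)).re ≤ ε := by
  rcases subsingleton_or_nontrivial A with hA | hA
  · have h10 : (1 : A) = 0 := Subsingleton.elim _ _
    exact ⟨0, le_rfl, h10.ge, by simpa using hε.le, by simpa [h10] using hε.le⟩
  obtain ⟨x, hx, hfx⟩ := (φp - φm).exists_lt_apply_of_lt_opNorm (sub_lt_self ‖φp - φm‖ hε)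
  obtain ⟨c, hc, hcx⟩ := RCLike.exists_norm_eq_mul_self ((φp - φm) x)
  set h : A := (realPart (c • x) : A)
  have hsa : IsSelfAdjoint h := (realPart (c • x)).2
  have hnorm : ‖h‖ ≤ 1 := by
    have := realPart.norm_le (c • x)
    rw [norm_smul, hc, one_mul] at this
    exact this.trans hx.le
  have hle : h ≤ 1 := by
    simpa using hsa.le_algebraMap_norm_self.trans (algebraMap_mono A hnorm)
  have hge : -1 ≤ h := by
    simpa using (neg_le_neg (algebraMap_mono A hnorm)).trans hsa.neg_algebraMap_norm_le_self
  have hval : ‖(φp - φm) x‖ = (φp h).re - (φm h).re := by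
    rw [hφp.re_apply_realPart, hφm.re_apply_realPart, ← Complex.sub_re,
      ← sub_apply, map_smul, smul_eq_mul, ← hcx]
    simp
  have hp := re_apply_one_le_norm φp
  have hm := re_apply_one_le_norm φm
  have hp_nonneg := (hφp _ (sub_nonneg.2 hle)).2
  have hm_nonneg := (hφm _ (neg_le_iff_add_nonneg'.1 hge)).2
  rw [map_sub, Complex.sub_re] at hp_nonneg
  rw [map_add, Complex.add_re] at hm_nonneg
  have hcompl : (1 : A) - (2⁻¹ : ℝ) • (1 - h) = (2⁻¹ : ℝ) • (1 + h) := by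
    module
  have real_smul (f : A →L[ℂ] ℂ) (y : A) : (f ((2⁻¹ : ℝ) • y)).re = 2⁻¹ * (f y).re := by
    rw [← Complex.coe_smul, map_smul, smul_eq_mul, Complex.re_ofReal_mul]
  refine ⟨(2⁻¹ : ℝ) • (1 - h), smul_nonneg (by norm_num) (sub_nonneg.2 hle), ?_, ?_, ?_⟩
  · rw [← sub_nonneg, hcompl]
    exact smul_nonneg (by norm_num) (neg_le_iff_add_nonneg'.1 hge)
  · rw [real_smul, map_sub, Complex.sub_re]
    linarith
  · rw [hcompl, real_smul, map_add, Complex.add_re]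
    linarith
end

section
/- Let A be a commutative unital C*-algebra, X a compact Hausdorff space, δ ≥ 0, and φ : A → C(X,ℂ) a bounded self-adjoint linear map whose pointwise norm function is δ-continuous, i.e. for every t₀ ∈ X, limsup_{t→t₀} ‖φ_t‖ ≤ ‖φ_{t₀}‖ + δ and liminf_{t→t₀} ‖φ_t‖ ≥ ‖φ_{t₀}‖ − δ. For h ∈ A with h ≥ 0 let P(h)(t) = sup{ φ(g)(t) : g ∈ A, 0 ≤ g ≤ h } denote the pointwise positive Jordan part. Then for every h ≥ 0 and every t₀ ∈ X, limsup_{t→t₀} P(h)(t) ≤ P(h)(t₀) + δ‖h‖ and liminf_{t→t₀} P(h)(t) ≥ P(h)(t₀) − δ‖h‖. -/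
open Filter

section PositivePart

open scoped ComplexStarModule ComplexOrder

variable {A : Type*} [CommCStarAlgebra A] [PartialOrder A] [StarOrderedRing A]

/-- In a commutative C⋆-algebra, positivity can be tested on characters. -/
theorem CommCStarAlgebra.nonneg_of_forall_character {a : A} (ha : IsSelfAdjoint a)
    (h : ∀ χ : WeakDual.characterSpace ℂ A, 0 ≤ χ a) : 0 ≤ a := by
  rw [nonneg_iff_isSelfAdjoint_and_quasispectrumRestricts]
  refine ⟨ha, ?_⟩
  rw [quasispectrumRestricts_iff_spectrumRestricts]
  rw [SpectrumRestricts.nnreal_iff]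
  intro x hx
  obtain ⟨χ, hχ⟩ := WeakDual.CharacterSpace.mem_spectrum_iff_exists.1
    (ha.coe_mem_spectrum_complex.2 hx)
  exact Complex.zero_le_real.1 (hχ ▸ h χ)

theorem CommCStarAlgebra.character_nonneg {a : A} (ha : 0 ≤ a)
    (χ : WeakDual.characterSpace ℂ A) : 0 ≤ χ a := by
  apply spectrum_nonneg_of_nonneg ha
  exact WeakDual.CharacterSpace.mem_spectrum_iff_exists.2 ⟨χ, rfl⟩

/-- The positive part is the least upper bound of `x` and `0`. -/
theorem CommCStarAlgebra.posPart_le {x k : A} (hx : IsSelfAdjoint x) (hk : 0 ≤ k)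
    (hxk : x ≤ k) : x⁺ ≤ k := by
  rw [← sub_nonneg]
  refine nonneg_of_forall_character
    ((IsSelfAdjoint.of_nonneg hk).sub (.of_nonneg (CFC.posPart_nonneg x))) fun χ => ?_
  have h0 : χ x⁺ * χ x⁻ = 0 := by rw [← map_mul, CFC.posPart_mul_negPart, map_zero]
  rcases mul_eq_zero.1 h0 with h | h
  · rw [map_sub, h, sub_zero]
    exact character_nonneg hk χ
  · have : χ (k - x⁺) = χ (k - x) := by
      conv_rhs => rw [← CFC.posPart_sub_negPart x hx]
      simp [h]
    rw [this]
    exact character_nonneg (sub_nonneg.2 hxk) χ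

/-- Riesz decomposition property of commutative C⋆-algebras. -/
theorem CommCStarAlgebra.exists_add_of_le_add {g h k : A} (hg : 0 ≤ g) (hh : 0 ≤ h) (hk : 0 ≤ k)
    (hle : g ≤ h + k) :
    ∃ g₁ g₂ : A, (0 ≤ g₁ ∧ g₁ ≤ h) ∧ (0 ≤ g₂ ∧ g₂ ≤ k) ∧ g = g₁ + g₂ := by
  have hx : IsSelfAdjoint (g - h) := (IsSelfAdjoint.of_nonneg hg).sub (.of_nonneg hh)
  refine ⟨g - (g - h)⁺, (g - h)⁺, ⟨?_, ?_⟩, ⟨CFC.posPart_nonneg _, ?_⟩, by abel⟩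
  · exact sub_nonneg.2 (posPart_le hx hg (sub_le_self _ hh))
  · exact sub_le_comm.1 (CFC.le_posPart hx)
  · exact posPart_le hx hk (sub_le_iff_le_add'.2 hle)

theorem CommCStarAlgebra.norm_two_mul_sub_algebraMap_le {g : A} {c : ℝ} (hc : 0 ≤ c) (hg : 0 ≤ g)
    (hgc : g ≤ algebraMap ℝ A c) : ‖2 * g - algebraMap ℝ A c‖ ≤ c := by
  have hgs := IsSelfAdjoint.of_nonneg hg
  set b := algebraMap ℝ A c - g with hb
  have hb0 : 0 ≤ b := sub_nonneg.2 hgc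
  have hbs := IsSelfAdjoint.of_nonneg hb0
  have hx : 2 * g - algebraMap ℝ A c = g - b := by rw [hb]; ring
  have hxs : IsSelfAdjoint (g - b) := hgs.sub hbs
  rw [hx]
  have hgb : 0 ≤ g * b := by
    refine nonneg_of_forall_character (hgs.mul hbs) fun χ => ?_
    rw [map_mul]
    exact mul_nonneg (character_nonneg hg χ) (character_nonneg hb0 χ)
  have key : star (g - b) * (g - b) ≤ algebraMap ℝ A (c ^ 2) := by
    rw [← sub_nonneg]
    have : algebraMap ℝ A (c ^ 2) - star (g - b) * (g - b) = g * b + g * b + (g * b + g * b) := by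
      rw [hxs.star_eq, map_pow, hb]; ring
    rw [this]
    positivity
  rw [← CStarAlgebra.norm_le_iff_le_algebraMap _ (by positivity) (star_mul_self_nonneg _),
    CStarRing.norm_star_mul_self, ← sq] at key
  exact (sq_le_sq₀ (norm_nonneg _) hc).1 key

/-- The value at `h` of the positive part in the Jordan decomposition of the real part of `f`. -/
noncomputable def jordanPos (f : A →L[ℂ] ℂ) (h : A) : ℝ :=
  sSup {r : ℝ | ∃ g : A, 0 ≤ g ∧ g ≤ h ∧ r = (f g).re}

variable (f : A →L[ℂ] ℂ) {g h k : A}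

theorem re_apply_le_norm_mul (hg : 0 ≤ g) (hgh : g ≤ h) : (f g).re ≤ ‖f‖ * ‖h‖ :=
  (Complex.re_le_norm _).trans <| (f.le_opNorm g).trans <| by
    gcongr
    exact CStarAlgebra.norm_le_norm_of_nonneg_of_le hg hgh

theorem re_apply_le_jordanPos (hg : 0 ≤ g) (hgh : g ≤ h) : (f g).re ≤ jordanPos f h := by
  refine le_csSup ⟨‖f‖ * ‖h‖, ?_⟩ ⟨g, hg, hgh, rfl⟩
  rintro _ ⟨g, hg, hgh, rfl⟩
  exact re_apply_le_norm_mul f hg hgh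

theorem jordanPos_le {b : ℝ} (hh : 0 ≤ h) (hb : ∀ g : A, 0 ≤ g → g ≤ h → (f g).re ≤ b) :
    jordanPos f h ≤ b := by
  refine csSup_le ⟨_, 0, le_rfl, hh, rfl⟩ ?_
  rintro _ ⟨g, hg, hgh, rfl⟩
  exact hb g hg hgh

theorem jordanPos_nonneg (hh : 0 ≤ h) : 0 ≤ jordanPos f h := by
  simpa using re_apply_le_jordanPos f le_rfl hh

/-- The positive part is additive on the positive cone. -/
theorem jordanPos_add (hh : 0 ≤ h) (hk : 0 ≤ k) :
    jordanPos f (h + k) = jordanPos f h + jordanPos f k := by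
  apply le_antisymm
  · refine jordanPos_le f (add_nonneg hh hk) fun g hg hgle => ?_
    obtain ⟨g₁, g₂, h₁, h₂, rfl⟩ := CommCStarAlgebra.exists_add_of_le_add hg hh hk hgle
    rw [map_add, Complex.add_re]
    exact add_le_add (re_apply_le_jordanPos f h₁.1 h₁.2) (re_apply_le_jordanPos f h₂.1 h₂.2)
  · rw [← le_sub_iff_add_le]
    refine jordanPos_le f hh fun g hg hgh => ?_
    rw [le_sub_comm]
    refine jordanPos_le f hk fun g' hg' hgk => ?_
    rw [le_sub_iff_add_le', ← Complex.add_re, ← map_add]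
    exact re_apply_le_jordanPos f (add_nonneg hg hg') (add_le_add hgh hgk)

theorem two_mul_jordanPos_algebraMap_le {c : ℝ} (hc : 0 ≤ c) :
    2 * jordanPos f (algebraMap ℝ A c) ≤ c * ‖f‖ + (f (algebraMap ℝ A c)).re := by
  rw [← le_div_iff₀' two_pos]
  refine jordanPos_le f (by simpa using algebraMap_mono A hc) fun g hg hgc => ?_
  rw [le_div_iff₀' two_pos, ← sub_le_iff_le_add]
  have h1 : (f (2 * g - algebraMap ℝ A c)).re ≤ c * ‖f‖ :=
    (Complex.re_le_norm _).trans <| (f.le_opNorm _).trans <| by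
      rw [mul_comm c]
      gcongr
      exact CommCStarAlgebra.norm_two_mul_sub_algebraMap_le hc hg hgc
  rw [two_mul, map_sub, map_add] at h1
  simpa [two_mul] using h1

theorem le_two_mul_jordanPos_algebraMap (hf : ∀ a, f (star a) = star (f a)) {c : ℝ} (hc : 0 ≤ c) :
    c * ‖f‖ + (f (algebraMap ℝ A c)).re ≤ 2 * jordanPos f (algebraMap ℝ A c) := by
  -- self-adjoint contractions, scaled by `c`
  have hsa : ∀ s : A, IsSelfAdjoint s → ‖s‖ ≤ c →
      (f s).re ≤ 2 * jordanPos f (algebraMap ℝ A c) - (f (algebraMap ℝ A c)).re := by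
    intro s hs hsc
    have hmono : algebraMap ℝ A ‖s‖ ≤ algebraMap ℝ A c := algebraMap_mono A hsc
    have h1 : s ≤ algebraMap ℝ A c := hs.le_algebraMap_norm_self.trans hmono
    have h2 : -algebraMap ℝ A c ≤ s := (neg_le_neg hmono).trans hs.neg_algebraMap_norm_le_self
    have h3 := re_apply_le_jordanPos f (g := (2⁻¹ : ℝ) • (s + algebraMap ℝ A c))
      (h := algebraMap ℝ A c) (smul_nonneg (by norm_num) (neg_le_iff_add_nonneg.1 h2)) (by
        rw [inv_smul_le_iff_of_pos two_pos, two_smul]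
        gcongr)
    rw [← Complex.coe_smul, map_smul, map_add] at h3
    simp at h3
    linarith
  have hcf : ‖(c : ℂ) • f‖ = c * ‖f‖ := by
    rw [norm_smul, Complex.norm_real, Real.norm_of_nonneg hc]
  have hre : ∀ s : A, (f (ℜ s : A)).re = (f s).re := by
    intro s
    rw [realPart_apply_coe, ← Complex.coe_smul, map_smul, map_add, hf]
    simp
    ring
  rw [← le_sub_iff_add_le, ← hcf]
  refine ContinuousLinearMap.opNorm_le_of_unit_norm ?_ fun a ha => ?_
  · simpa using hsa 0 (.zero _) (by simpa using hc)
  · obtain ⟨u, hu, hua⟩ : ∃ u : ℂ, ‖u‖ ≤ 1 ∧ u * f a = ‖f a‖ := by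
      refine ⟨star (f a) / ‖f a‖, ?_, ?_⟩
      · rw [norm_div, norm_star, Complex.norm_real, norm_norm]
        exact div_self_le_one _
      · rw [div_mul_eq_mul_div, Complex.star_def, Complex.conj_mul', sq, mul_self_div_self]
    have h1 := hsa (ℜ (((c : ℂ) * u) • a) : A) (ℜ (((c : ℂ) * u) • a)).2 (by
      refine (realPart.norm_le (((c : ℂ) * u) • a)).trans ?_
      rw [norm_smul, ha, norm_mul, Complex.norm_real, Real.norm_of_nonneg hc, mul_one]
      exact mul_le_of_le_one_right hc hu)
    rw [hre, map_smul, smul_eq_mul, mul_assoc, hua, ← Complex.ofReal_mul, Complex.ofReal_re] at h1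
    simpa [abs_of_nonneg hc] using h1

end PositivePart

/-- Let `A` be a commutative unital C*-algebra, `X` a compact
Hausdorff space, `δ ≥ 0` and `φ : A → C(X, ℂ)` a bounded self-adjoint linear map
whose pointwise norm function `t ↦ ‖φ_t‖` is `δ`-continuous.  For `0 ≤ h` let
`P h t = sup {φ(g)(t) : 0 ≤ g ≤ h}` be the pointwise positive Jordan part.  Then
for every `0 ≤ h` the function `P h` is `δ‖h‖`-continuous, i.e. for every `t₀`,
`limsup_{t → t₀} P h t ≤ P h t₀ + δ‖h‖` and
`liminf_{t → t₀} P h t ≥ P h t₀ - δ‖h‖`. -/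
theorem stmt7
    {A : Type*} [CommCStarAlgebra A] [PartialOrder A] [StarOrderedRing A]
    {X : Type*} [TopologicalSpace X] [CompactSpace X] [T2Space X]
    (δ : ℝ) (hδ : 0 ≤ δ)
    (φ : A →L[ℂ] C(X, ℂ))
    (hsa : ∀ a : A, φ (star a) = star (φ a))
    (hδusc : ∀ t₀ : X,
      limsup (fun t : X => ‖fiberFunctional φ t‖) (nhds t₀) ≤
        ‖fiberFunctional φ t₀‖ + δ)
    (hδlsc : ∀ t₀ : X,
      ‖fiberFunctional φ t₀‖ - δ ≤
        liminf (fun t : X => ‖fiberFunctional φ t‖) (nhds t₀))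
    (P : A → X → ℝ)
    (hP : ∀ (h : A) (t : X),
      P h t = sSup {r : ℝ | ∃ g : A, 0 ≤ g ∧ g ≤ h ∧ r = (φ g t).re}) :
    ∀ (h : A), 0 ≤ h → ∀ t₀ : X,
      limsup (fun t : X => P h t) (nhds t₀) ≤ P h t₀ + δ * ‖h‖ ∧
      P h t₀ - δ * ‖h‖ ≤ liminf (fun t : X => P h t) (nhds t₀) := by
  intro h hh t₀
  set F := fiberFunctional φ with hF
  have hP' : ∀ k t, P k t = jordanPos (F t) k := hP
  have hFsa : ∀ t a, F t (star a) = star (F t a) := fun t a => by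
    simp [hF, fiberFunctional, hsa]
  have hcont : ∀ a, Continuous fun t => (F t a).re := fun a =>
    Complex.continuous_re.comp (φ a).continuous
  have hFle : ∀ t, ‖F t‖ ≤ ‖φ‖ := fun t =>
    (F t).opNorm_le_bound (norm_nonneg _) fun a =>
      ((φ a).norm_coe_le_norm t).trans (φ.le_opNorm a)
  have hlsc : ∀ k, 0 ≤ k → ∀ b < P k t₀, ∀ᶠ t in nhds t₀, b < P k t := by
    intro k hk b hb
    rw [hP] at hb
    obtain ⟨_, ⟨g, hg, hgk, rfl⟩, hbg⟩ :=
      exists_lt_of_lt_csSup (by exact ⟨_, 0, le_rfl, hk, rfl⟩) hb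
    filter_upwards [(hcont g).continuousAt.eventually_const_lt hbg] with t ht
    rw [hP']
    exact ht.trans_le (re_apply_le_jordanPos (F t) hg hgk)
  have hP0 : ∀ t, 0 ≤ P h t := fun t => (hP' h t).symm ▸ jordanPos_nonneg (F t) hh
  have hPle : ∀ t, P h t ≤ ‖φ‖ * ‖h‖ := fun t => by
    rw [hP']
    refine jordanPos_le (F t) hh fun g hg hgh => (re_apply_le_norm_mul (F t) hg hgh).trans ?_
    gcongr
    exact hFle t
  have hbdd : (nhds t₀).IsBoundedUnder (· ≤ ·) (P h) := isBoundedUnder_of ⟨_, hPle⟩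
  have hbdd' : (nhds t₀).IsBoundedUnder (· ≥ ·) (P h) := isBoundedUnder_of ⟨_, hP0⟩
  have hδh : 0 ≤ δ * ‖h‖ := by positivity
  constructor
  · refine le_of_forall_pos_le_add fun ε hε => ?_
    refine limsup_le_of_le hbdd'.isCoboundedUnder_le ?_
    set c := ‖h‖ with hc
    set e : A := algebraMap ℝ A c with he
    have hc0 : 0 ≤ c := norm_nonneg h
    have hk : 0 ≤ e - h := sub_nonneg.2 (IsSelfAdjoint.of_nonneg hh).le_algebraMap_norm_self
    have hadd : ∀ t, P h t = jordanPos (F t) e - P (e - h) t := fun t => by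
      rw [hP', hP', eq_sub_iff_add_eq, ← jordanPos_add _ hh hk, add_sub_cancel]
    set η := ε / (c + 2) with hη
    have hη0 : 0 < η := by positivity
    have hεη : ε = η * (c + 2) := by rw [hη]; field_simp
    have hnorm : ∀ᶠ t in nhds t₀, ‖F t‖ < ‖F t₀‖ + δ + η :=
      eventually_lt_of_limsup_lt ((hδusc t₀).trans_lt (lt_add_of_pos_right _ hη0))
        (isBoundedUnder_of ⟨_, hFle⟩)
    filter_upwards [hnorm, hlsc (e - h) hk _ (sub_lt_self _ hη0),
      (hcont e).continuousAt.eventually_lt_const (lt_add_of_pos_right _ hη0)] with t h1 h2 h3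
    have h4 := two_mul_jordanPos_algebraMap_le (F t) hc0
    have h5 := le_two_mul_jordanPos_algebraMap (F t₀) (hFsa t₀) hc0
    have h6 := mul_le_mul_of_nonneg_left h1.le hc0
    rw [hadd t, hadd t₀]
    rw [← he] at h4 h5
    have h7 := mul_nonneg hc0 hη0.le
    nlinarith
  · refine le_of_forall_pos_sub_le fun ε hε => ?_
    refine le_liminf_of_le hbdd.isCoboundedUnder_ge ?_
    filter_upwards [hlsc h hh _ (sub_lt_self _ hε)] with t ht
    linarith
end
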